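/- arXiv:1611.09681 — 6 statements merged into one kernel-verified Lean document; each statement's English description precedes it below -/
import Mathlib

section
/- Let 𝔣 : L → L be a continuous 𝔽_q-linear map, and let (f_0,…,f_{d−1}) ∈ L^d be the unique tuple satisfying ∑_{i≥0} φ_i·ζ_k^i = ∑_{l=0}^{d−1} f_l·ζ_k^l for all k = 1,…,d. Then the series ∑_{i≥0} 𝔣(φ_i)·ζ_k^i converges and equals ∑_{l=0}^{d−1} 𝔣(f_l)·ζ_k^l, for every k = 1,…,d. -/
/-- An element fixed by `x ↦ x ^ q` is fixed by all its iterates. -/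
theorem pow_pow_eq_self_of_pow_eq_self {M : Type*} [Monoid M] {x : M} {q : ℕ} (hx : x ^ q = x)
    (n : ℕ) : x ^ q ^ n = x := by
  induction n with
  | zero => simp
  | succ n ih => rw [pow_succ, pow_mul, ih, hx]

/-- Two polynomial expressions of degree less than `d` that agree at `d` distinct points have the
same coefficients. -/
theorem eq_of_forall_sum_range_mul_pow_eq {R : Type*} [CommRing R] [IsDomain R] {d : ℕ}
    {z : Fin d → R} (hz : Function.Injective z) {u v : ℕ → R}
    (h : ∀ k, ∑ l ∈ Finset.range d, u l * z k ^ l = ∑ l ∈ Finset.range d, v l * z k ^ l)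
    {l : ℕ} (hl : l < d) : u l = v l := by
  have key := Matrix.eq_zero_of_forall_index_sum_mul_pow_eq_zero
    (v := fun i : Fin d => u i - v i) hz fun k => by
      rw [Fin.sum_univ_eq_sum_range (fun i => (u i - v i) * z k ^ i)]
      simp only [sub_mul, Finset.sum_sub_distrib, h k, sub_self]
  exact sub_eq_zero.mp (congrFun key ⟨l, hl⟩)

/-- In a complete nonarchimedean normed field, a null sequence stays summable after multiplication
by a sequence of elements of norm at most one. -/
theorem summable_mul_of_tendsto_norm_zero_of_norm_le_one {L : Type*} [NormedField L]
    [CompleteSpace L] (hna : IsNonarchimedean (fun x : L => ‖x‖)) {φ c : ℕ → L}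
    (hφ : Filter.Tendsto (fun i => ‖φ i‖) Filter.atTop (nhds 0)) (hc : ∀ i, ‖c i‖ ≤ 1) :
    Summable fun i => φ i * c i := by
  have : IsUltrametricDist L := IsUltrametricDist.isUltrametricDist_of_isNonarchimedean_norm hna
  apply NonarchimedeanAddGroup.summable_of_tendsto_cofinite_zero
  rw [Nat.cofinite_eq_atTop]
  refine squeeze_zero_norm (fun i => ?_) hφ
  rw [norm_mul]
  exact mul_le_of_le_one_right (norm_nonneg _) (hc i)

/-- Evaluation at roots of unity and twisting.
With `L`, `ζ`, `(φ_i)` as before, let `𝔣 : L → L` be a continuous `𝔽_q`-linear map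
and let `(f_0, …, f_{d-1})` be the unique tuple with
`∑_{i ≥ 0} φ_i ζ_k^i = ∑_{l=0}^{d-1} f_l ζ_k^l` for all conjugates `ζ_k` of `ζ`.
Then `∑_{i ≥ 0} 𝔣(φ_i) ζ_k^i` converges and equals `∑_{l=0}^{d-1} 𝔣(f_l) ζ_k^l`
for every `k`. -/
theorem stmt_1 {L : Type*} [NormedField L] [CompleteSpace L]
    (hna : IsNonarchimedean (fun x : L => ‖x‖))
    (p q κ : ℕ) (hp : p.Prime) (hκ : 0 < κ) (hq : q = p ^ κ)
    (hchar : CharP L p)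
    (d : ℕ) (hd : 0 < d)
    (ζ : L) (hζ0 : ζ ≠ 0) (hζq : ζ ^ q ^ d = ζ)
    (htriv : ∀ x : L, x ≠ 0 → x ^ q ^ d = x → ‖x‖ = 1)
    (hdeg : Function.Injective fun k : Fin d => ζ ^ q ^ (k : ℕ))
    (φ : ℕ → L) (hφ : Filter.Tendsto (fun i => ‖φ i‖) Filter.atTop (nhds 0))
    (a : ℕ → ℕ → L)
    (haF : ∀ j l, a j l ^ q = a j l)
    (ha : ∀ j < q ^ d - 1, ζ ^ j = ∑ l ∈ Finset.range d, a j l * ζ ^ l)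
    (𝔣 : L → L) (h𝔣cont : Continuous 𝔣)
    (h𝔣add : ∀ x y : L, 𝔣 (x + y) = 𝔣 x + 𝔣 y)
    (h𝔣smul : ∀ s x : L, s ^ q = s → 𝔣 (s * x) = s * 𝔣 x)
    (f : ℕ → L)
    (hf : ∀ k : Fin d,
      HasSum (fun i : ℕ => φ i * (ζ ^ q ^ (k : ℕ)) ^ i)
        (∑ l ∈ Finset.range d, f l * (ζ ^ q ^ (k : ℕ)) ^ l)) :
    ∀ k : Fin d,
      HasSum (fun i : ℕ => 𝔣 (φ i) * (ζ ^ q ^ (k : ℕ)) ^ i)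
        (∑ l ∈ Finset.range d, 𝔣 (f l) * (ζ ^ q ^ (k : ℕ)) ^ l) := by
  have hq1 : 1 < q := hq ▸ Nat.one_lt_pow hκ.ne' hp.one_lt
  have hN : 0 < q ^ d - 1 := Nat.sub_pos_of_lt (Nat.one_lt_pow hd.ne' hq1)
  have hζN : ζ ^ (q ^ d - 1) = 1 := by
    apply mul_right_cancel₀ hζ0
    rw [← pow_succ, Nat.sub_add_cancel (Nat.one_le_of_lt (Nat.one_lt_pow hd.ne' hq1)), hζq, one_mul]
  let c : ℕ → ℕ → L := fun i l => a (i % (q ^ d - 1)) l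
  have hcq : ∀ i l, c i l ^ q = c i l := fun i l => haF _ _
  have hcζ : ∀ i, ζ ^ i = ∑ l ∈ Finset.range d, c i l * ζ ^ l := fun i => by
    rw [← ha _ (Nat.mod_lt i hN)]
    exact pow_eq_pow_mod i hζN
  have hck : ∀ (k i : ℕ),
      (ζ ^ q ^ k) ^ i = ∑ l ∈ Finset.range d, c i l * (ζ ^ q ^ k) ^ l := fun k i => by
    have := hchar
    have := Fact.mk hp
    have h := congrArg (iterateFrobenius L p (κ * k)) (hcζ i)
    simp only [map_sum, map_mul, iterateFrobenius_def, pow_mul p κ k, ← hq,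
      pow_pow_eq_self_of_pow_eq_self (hcq _ _)] at h
    simpa only [pow_right_comm ζ _ (q ^ k)] using h
  have hcn : ∀ i l, ‖c i l‖ ≤ 1 := fun i l => by
    rcases eq_or_ne (c i l) 0 with h | h
    · simp [h]
    · exact (htriv _ h (pow_pow_eq_self_of_pow_eq_self (hcq i l) d)).le
  have hsum : ∀ l, Summable fun i => φ i * c i l := fun l =>
    summable_mul_of_tendsto_norm_zero_of_norm_le_one hna hφ fun i => hcn i l
  have hcomb : ∀ (k : ℕ) (u g : ℕ → L), (∀ l < d, HasSum (fun i => u i * c i l) (g l)) →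
      HasSum (fun i => u i * (ζ ^ q ^ k) ^ i)
        (∑ l ∈ Finset.range d, g l * (ζ ^ q ^ k) ^ l) := fun k u g h => by
    have hterm : (fun i => u i * (ζ ^ q ^ k) ^ i) =
        fun i => ∑ l ∈ Finset.range d, u i * c i l * (ζ ^ q ^ k) ^ l := funext fun i => by
      rw [hck k i, Finset.mul_sum]
      simp only [mul_assoc]
    rw [hterm]
    exact hasSum_sum fun l hl => (h l (Finset.mem_range.mp hl)).mul_right _
  have hS : ∀ l < d, ∑' i, φ i * c i l = f l := fun l hl => by
    refine eq_of_forall_sum_range_mul_pow_eq (u := fun l => ∑' i, φ i * c i l) hdeg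
      (fun k => ?_) hl
    exact (hcomb k _ _ fun l _ => (hsum l).hasSum).unique (hf k)
  refine fun k => hcomb k _ _ fun l hl => ?_
  have h := (hsum l).hasSum.map (AddMonoidHom.mk' 𝔣 h𝔣add) h𝔣cont
  rw [hS l hl] at h
  refine (funext fun i => ?_ : _ = fun i => 𝔣 (φ i) * c i l) ▸ h
  simp [mul_comm _ (c i l), h𝔣smul _ _ (hcq i l)]
end

section
/- For every n ≥ 0 and every i = 0,…,d−1, the coefficient c_{(n),i} is Carlitz 𝔭^{n+1}-torsion: 𝔠_{𝔭^{n+1}}(c_{(n),i}) = 0, i.e. c_{(n),i} ∈ C[𝔭^{n+1}]. Consequently ω^{(n)}(ζ) = ∑_{i=0}^{d−1} c_{(n),i}·ζ^i lies in A_n[ζ], where A_n denotes the integral closure of A in the subfield of L generated over K by C[𝔭^{n+1}]; in particular ω^{(n)}(ζ) is integral over A[ζ]. -/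
open Polynomial Filter Topology

/-- Elements algebraic over a finite field lie in the closed unit ball. -/
theorem norm_le_one_of_isIntegral_finite {𝔽 L : Type*} [Field 𝔽] [Finite 𝔽] [NormedField L]
    [Algebra 𝔽 L] {z : L} (hz : IsIntegral 𝔽 z) : ‖z‖ ≤ 1 := by
  by_contra! h
  have : Module.Finite 𝔽 (Algebra.adjoin 𝔽 {z}) := Algebra.finite_adjoin_simple_of_isIntegral hz
  have : Finite (Algebra.adjoin 𝔽 {z}) := Module.finite_of_finite 𝔽
  refine not_injective_infinite_finite
    (fun n : ℕ => (⟨z, Algebra.self_mem_adjoin_singleton 𝔽 z⟩ : Algebra.adjoin 𝔽 {z}) ^ n) ?_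
  intro a b hab
  have h1 : z ^ a = z ^ b := congrArg Subtype.val hab
  have h2 : ‖z‖ ^ a = ‖z‖ ^ b := by rw [← norm_pow, h1, norm_pow]
  exact (pow_right_strictMono₀ h).injective h2

/-- A power series vanishing identically on the closed unit ball is zero. -/
theorem eq_zero_of_hasSum_pow_zero {𝕜 : Type*} [NontriviallyNormedField 𝕜] {v : ℕ → 𝕜}
    (hv : ∀ z : 𝕜, ‖z‖ ≤ 1 → HasSum (fun i => v i * z ^ i) 0) : v = 0 := by
  have h : HasFPowerSeriesAt (0 : 𝕜 → 𝕜) (FormalMultilinearSeries.ofScalars 𝕜 v) 0 := by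
    rw [hasFPowerSeriesAt_iff]
    filter_upwards [Metric.closedBall_mem_nhds (0 : 𝕜) one_pos] with z hz
    simpa [FormalMultilinearSeries.coeff_ofScalars, mul_comm] using hv z (by simpa using hz)
  funext i
  have := congrArg (fun s => s.coeff i) h.eq_zero
  exact FormalMultilinearSeries.coeff_ofScalars.symm.trans this

theorem eq_zero_of_hasSum_pow_zero_of_one_lt_norm {L : Type*} [NormedField L] {x : L}
    (hx : 1 < ‖x‖) {v : ℕ → L} (hv : ∀ z : L, ‖z‖ ≤ 1 → HasSum (fun i => v i * z ^ i) 0) : v = 0 :=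
  let _ : NontriviallyNormedField L := { (inferInstance : NormedField L) with
    non_trivial := ⟨x, hx⟩ }
  eq_zero_of_hasSum_pow_zero hv

/-- If `f ^ (m + 1)` divides `g`, then `f` divides the Hasse derivatives of `g` up to order `m`. -/
theorem Polynomial.dvd_hasseDeriv_of_pow_succ_dvd {R : Type*} [CommRing R] {f : R[X]} (m : ℕ) :
    ∀ {g : R[X]} {n : ℕ}, f ^ (m + 1) ∣ g → n ≤ m → f ∣ hasseDeriv n g := by
  induction m with
  | zero =>
    intro g n hg hn
    obtain rfl : n = 0 := by omega
    simpa using hg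
  | succ m ih =>
    rintro _ n ⟨h, rfl⟩ hn
    rw [pow_succ', mul_assoc, hasseDeriv_mul]
    refine Finset.dvd_sum fun ij hij => ?_
    replace hij := Finset.HasAntidiagonal.mem_antidiagonal.1 hij
    rcases Nat.eq_zero_or_pos ij.1 with h0 | h0
    · rw [h0, hasseDeriv_zero']
      exact dvd_mul_right _ _
    · exact (ih (dvd_mul_right _ h) (by omega)).mul_left _

/-- The conjugates `ζ ^ q ^ k`, `k < d`, of a root of an irreducible polynomial of degree `d` over
the field with `q` elements are distinct. -/
theorem injOn_pow_card_pow_of_irreducible {𝔽 L : Type*} [Field 𝔽] [Fintype 𝔽] [Field L]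
    [Algebra 𝔽 L] {f : 𝔽[X]} (hf : Irreducible f) {ζ : L} (hζ : aeval ζ f = 0) :
    Function.Injective (fun k : Fin f.natDegree => ζ ^ Fintype.card 𝔽 ^ (k : ℕ)) := by
  have key : ∀ a m : ℕ, a + m < f.natDegree →
      ζ ^ Fintype.card 𝔽 ^ a = ζ ^ Fintype.card 𝔽 ^ (a + m) → m = 0 := by
    intro a m hm h
    have hF : ∀ x : L, (FiniteField.frobeniusAlgHom 𝔽 L ^ a) x = x ^ Fintype.card 𝔽 ^ a := by
      intro x
      rw [AlgHom.coe_pow, FiniteField.coe_frobeniusAlgHom, pow_iterate]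
    have h1 : ζ = ζ ^ Fintype.card 𝔽 ^ m := by
      apply (FiniteField.frobeniusAlgHom 𝔽 L ^ a).toRingHom.injective
      change (FiniteField.frobeniusAlgHom 𝔽 L ^ a) _ = (FiniteField.frobeniusAlgHom 𝔽 L ^ a) _
      rw [hF, hF, ← pow_mul, ← pow_add, add_comm m a, h]
    have h2 : f ∣ X ^ Nat.card 𝔽 ^ m - X := by
      refine (hf.dvd_iff_aeval_eq_zero hζ).1 ?_
      simp [Nat.card_eq_fintype_card, ← h1]
    exact Nat.eq_zero_of_dvd_of_lt (hf.natDegree_dvd_of_dvd_X_pow_card_pow_sub_X h2) (by omega)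
  intro a b hab
  have hab' : ζ ^ Fintype.card 𝔽 ^ (a : ℕ) = ζ ^ Fintype.card 𝔽 ^ (b : ℕ) := hab
  rcases le_total (a : ℕ) b with h | h
  · obtain ⟨m, hm⟩ := Nat.exists_eq_add_of_le h
    have := key a m (by omega) (by rw [hab', hm])
    exact Fin.ext (by omega)
  · obtain ⟨m, hm⟩ := Nat.exists_eq_add_of_le h
    have := key b m (by omega) (by rw [← hab', hm])
    exact Fin.ext (by omega)

/-- Two coefficient families agreeing as polynomials of degree `< d` at `d` distinct points are
equal. -/
theorem eq_of_sum_mul_pow_eq {L : Type*} [Field L] {d : ℕ} {z : Fin d → L}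
    (hz : Function.Injective z) {b c : ℕ → L}
    (h : ∀ k, ∑ i ∈ Finset.range d, b i * z k ^ i = ∑ i ∈ Finset.range d, c i * z k ^ i) :
    ∀ i < d, b i = c i := by
  intro i hi
  have := Matrix.eq_zero_of_forall_index_sum_mul_pow_eq_zero hz
    (v := fun i : Fin d => b i - c i) (by
      intro k
      have := h k
      rw [Finset.sum_range, Finset.sum_range] at this
      simp only [sub_mul, Finset.sum_sub_distrib, this, sub_self])
  exact sub_eq_zero.1 (congrFun this ⟨i, hi⟩)

/-- Torsion points of the Carlitz module for a monic polynomial are integral over any subring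
containing the constants and `θ`. -/
theorem isIntegral_of_carlitz_torsion {𝔽 L : Type*} [Field 𝔽] [Field L] [Algebra 𝔽 L]
    {q : ℕ} (hq : 1 < q) {θ : L} {𝔠 : 𝔽[X] → L → L}
    (hc_add : ∀ a b : 𝔽[X], ∀ x : L, 𝔠 (a + b) x = 𝔠 a x + 𝔠 b x)
    (hc_mul : ∀ a b : 𝔽[X], ∀ x : L, 𝔠 (a * b) x = 𝔠 a (𝔠 b x))
    (hc_C : ∀ (s : 𝔽) (x : L), 𝔠 (C s) x = algebraMap 𝔽 L s * x)
    (hc_X : ∀ x : L, 𝔠 X x = x ^ q + θ * x)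
    {S : Subring L} (hS : ∀ s : 𝔽, algebraMap 𝔽 L s ∈ S) (hθ : θ ∈ S)
    {a : 𝔽[X]} (ha : a.Monic) {x : L} (hx : 𝔠 a x = 0) : IsIntegral S x := by
  have hpow : ∀ m : ℕ, ∃ Q : S[X], Q.Monic ∧ Q.natDegree = q ^ m ∧ 𝔠 (X ^ m) x = aeval x Q := by
    intro m
    induction m with
    | zero =>
      refine ⟨X, monic_X, by simp, ?_⟩
      rw [pow_zero, ← C_1, hc_C]
      simp
    | succ m ih =>
      obtain ⟨Q, hQ, hdeg, hev⟩ := ih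
      have hlt : (C (⟨θ, hθ⟩ : S) * Q).degree < (Q ^ q).degree := by
        rw [C_mul']
        refine (degree_smul_le _ _).trans_lt ?_
        rw [degree_eq_natDegree hQ.ne_zero, degree_eq_natDegree (hQ.pow q).ne_zero,
          hQ.natDegree_pow, hdeg]
        have : 0 < q ^ m := by positivity
        exact_mod_cast (by nlinarith : q ^ m < q * q ^ m)
      refine ⟨Q ^ q + C ⟨θ, hθ⟩ * Q, (hQ.pow q).add_of_left hlt, ?_, ?_⟩
      · rw [natDegree_add_eq_left_of_degree_lt hlt, hQ.natDegree_pow, hdeg, pow_succ']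
      · rw [pow_succ', hc_mul, hc_X, hev]
        simp only [map_add, map_pow, map_mul, aeval_C]
        rfl
  choose Q hQ hdeg hev using hpow
  set n := a.natDegree
  let R : S[X] := ∑ i ∈ Finset.range n, (⟨algebraMap 𝔽 L (a.coeff i), hS _⟩ : S) • Q i
  have hR : R.degree < (Q n).degree := by
    rw [degree_eq_natDegree (hQ n).ne_zero, hdeg, ← mem_degreeLT]
    refine sum_mem fun i hi => Submodule.smul_mem _ _ ?_
    rw [mem_degreeLT, degree_eq_natDegree (hQ i).ne_zero, hdeg]
    exact_mod_cast Nat.pow_lt_pow_right hq (Finset.mem_range.1 hi)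
  refine ⟨Q n + R, (hQ n).add_of_left hR, ?_⟩
  have hsum := map_sum (AddMonoidHom.mk' (fun b => 𝔠 b x) fun b b' => hc_add b b' x)
    (fun i => C (a.coeff i) * X ^ i) (Finset.range n)
  simp only [AddMonoidHom.mk'_apply, hc_mul, hc_C, hev] at hsum
  rw [ha.as_sum, hc_add, hsum, hev] at hx
  rw [← aeval_def, map_add, ← hx, map_sum]
  simp only [map_smul]
  rfl

/-- The Taylor coefficients of the Anderson–Thakur function satisfy `𝔠_θ (w₀) = 0` and
`𝔠_θ (w_{i+1}) = w_i`, by the functional equation `ω^{(1)} = (z - θ) ω`. -/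
theorem andersonThakur_coeff {L : Type*} [NormedField L] [IsAlgClosed L]
    (𝔽 : Type*) [Field 𝔽] [Fintype 𝔽] [Algebra 𝔽 L] {q : ℕ} (hcard : Fintype.card 𝔽 = q)
    {θ : L} (hθ : 1 < ‖θ‖) {lam : L} (hlam : lam ^ (q - 1) = -θ) {w : ℕ → L}
    (hω : ∀ z : L, ‖z‖ ≤ 1 → ∃ P : L,
      HasProd (fun j : ℕ => (1 - z / θ ^ q ^ j)⁻¹) P ∧
      HasSum (fun i : ℕ => w i * z ^ i) (lam * P)) :
    w 0 ^ q + θ * w 0 = 0 ∧ ∀ i, w (i + 1) ^ q + θ * w (i + 1) = w i := by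
  have hq : 0 < q := hcard ▸ Fintype.card_pos
  have hF : ∀ x, FiniteField.frobeniusAlgHom 𝔽 L x = x ^ q := fun x => by
    rw [FiniteField.coe_frobeniusAlgHom, hcard]
  have hFc : Continuous (FiniteField.frobeniusAlgHom 𝔽 L) := by
    rw [FiniteField.coe_frobeniusAlgHom]
    exact continuous_pow _
  let s : ℕ → L := fun i => i.casesOn 0 w
  have hv : (fun i => w i ^ q + θ * w i - s i) = 0 := by
    refine eq_zero_of_hasSum_pow_zero_of_one_lt_norm hθ fun z hz => ?_
    obtain ⟨y, hy⟩ := IsAlgClosed.exists_pow_nat_eq z hq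
    have hy1 : ‖y‖ ≤ 1 := by
      rwa [← hy, norm_pow, pow_le_one_iff_of_nonneg (norm_nonneg _) hq.ne'] at hz
    obtain ⟨P, hP, hsum⟩ := hω z hz
    obtain ⟨P', hP', hsum'⟩ := hω y hy1
    have hPP : P = (1 - z / θ)⁻¹ * P' ^ q := by
      have h := hP'.map (FiniteField.frobeniusAlgHom 𝔽 L) hFc
      have h2 : HasProd (fun j : ℕ => (1 - z / θ ^ q ^ (j + 1))⁻¹) (P' ^ q) := by
        convert h using 1
        · funext j
          simp only [Function.comp_apply, map_inv₀, map_sub, map_div₀, map_one]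
          rw [hF, hF, hy]
          rw [← pow_mul, ← pow_succ]
        · rw [hF]
      have h3 := h2.zero_mul (f := fun j : ℕ => (1 - z / θ ^ q ^ j)⁻¹)
      simp only [pow_zero, pow_one] at h3
      exact hP.unique h3
    have hne : 1 - z / θ ≠ 0 := by
      intro h
      have h1 : z = θ := by
        have : θ ≠ 0 := norm_pos_iff.1 (by linarith)
        field_simp at h
        linear_combination -h
      rw [h1] at hz
      linarith
    have hlam' : lam ^ q = -θ * lam := by
      rw [← hlam, ← pow_succ, Nat.sub_add_cancel hq]
    have hθ0 : θ ≠ 0 := norm_pos_iff.1 (by linarith)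
    have h1 : HasSum (fun i => w i ^ q * z ^ i) ((z - θ) * (lam * P)) := by
      convert hsum'.map (FiniteField.frobeniusAlgHom 𝔽 L) hFc using 1
      · funext i
        simp only [Function.comp_apply, hF, mul_pow, ← hy]
        ring
      · rw [hF, mul_pow, hlam', hPP]
        have : z - θ = -θ * (1 - z / θ) := by field_simp; ring
        rw [this]
        linear_combination (-θ * lam * P' ^ q) * mul_inv_cancel₀ hne
    have h2 : HasSum (fun i => s i * z ^ i) (z * (lam * P)) := by
      have h3 : (fun i => s (i + 1) * z ^ (i + 1)) = fun i => z * (w i * z ^ i) := by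
        funext i
        simp only [s]
        ring
      have h4 := HasSum.zero_add (f := fun i => s i * z ^ i) (h3 ▸ hsum.mul_left z)
      have hs0 : s 0 = 0 := rfl
      simpa only [hs0, zero_mul, zero_add] using h4
    have h3 := (h1.add (hsum.mul_left θ)).sub h2
    rw [show (z - θ) * (lam * P) + θ * (lam * P) - z * (lam * P) = 0 by ring] at h3
    have h4 : (fun i => (w i ^ q + θ * w i - s i) * z ^ i) =
        fun i => w i ^ q * z ^ i + θ * (w i * z ^ i) - s i * z ^ i := by
      funext i
      ring
    rw [h4]
    exact h3
  refine ⟨?_, fun i => ?_⟩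
  · simpa [s] using congrFun hv 0
  · exact sub_eq_zero.1 (congrFun hv (i + 1))

/-- Pairing a null sequence with a linear functional on polynomials over a finite field gives a
summable family. -/
theorem summable_functional_smul {𝔽 L : Type*} [Field 𝔽] [Finite 𝔽] [NormedField L]
    [IsUltrametricDist L] [CompleteSpace L] [Algebra 𝔽 L] {w : ℕ → L}
    (hw : Tendsto w atTop (𝓝 0)) (ℓ : 𝔽[X] →ₗ[𝔽] 𝔽) : Summable fun j => ℓ (X ^ j) • w j := by
  refine NonarchimedeanAddGroup.summable_of_tendsto_cofinite_zero ?_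
  rw [Nat.cofinite_eq_atTop]
  refine squeeze_zero_norm (fun j => ?_) (tendsto_zero_iff_norm_tendsto_zero.1 hw)
  rw [Algebra.smul_def, norm_mul]
  exact mul_le_of_le_one_left (norm_nonneg _)
    (norm_le_one_of_isIntegral_finite (𝔽 := 𝔽) isIntegral_algebraMap)

/-- If `𝔠_θ` shifts the null sequence `w`, then `𝔠_a` acts on the sums `∑ ℓ(X ^ j) w_j` through
precomposition of `ℓ` with multiplication by `a`. -/
theorem carlitz_tsum_functional_smul {𝔽 L : Type*} [Field 𝔽] [Finite 𝔽] [NormedField L]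
    [IsUltrametricDist L] [CompleteSpace L] [Algebra 𝔽 L] {𝔠 : 𝔽[X] → L → L}
    (hc_add : ∀ a b : 𝔽[X], ∀ x : L, 𝔠 (a + b) x = 𝔠 a x + 𝔠 b x)
    (hc_mul : ∀ a b : 𝔽[X], ∀ x : L, 𝔠 (a * b) x = 𝔠 a (𝔠 b x))
    (hc_C : ∀ (s : 𝔽) (x : L), 𝔠 (C s) x = algebraMap 𝔽 L s * x)
    (hc_cont : Continuous (𝔠 X))
    (hc_lin : ∀ x y : L, 𝔠 X (x + y) = 𝔠 X x + 𝔠 X y)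
    (hc_smul : ∀ (s : 𝔽) (x : L), 𝔠 X (algebraMap 𝔽 L s * x) = algebraMap 𝔽 L s * 𝔠 X x)
    {w : ℕ → L} (hw : Tendsto w atTop (𝓝 0)) (h0 : 𝔠 X (w 0) = 0)
    (hs : ∀ i, 𝔠 X (w (i + 1)) = w i) (a : 𝔽[X]) (ℓ : 𝔽[X] →ₗ[𝔽] 𝔽) :
    𝔠 a (∑' j, ℓ (X ^ j) • w j) = ∑' j, ℓ (a * X ^ j) • w j := by
  have hX : ∀ ℓ : 𝔽[X] →ₗ[𝔽] 𝔽,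
      𝔠 X (∑' j, ℓ (X ^ j) • w j) = ∑' j, ℓ (X * X ^ j) • w j := by
    intro ℓ
    have h := (summable_functional_smul hw ℓ).hasSum.map (AddMonoidHom.mk' (𝔠 X) hc_lin) hc_cont
    change HasSum (fun j => 𝔠 X (ℓ (X ^ j) • w j)) (𝔠 X (∑' j, ℓ (X ^ j) • w j)) at h
    simp only [Algebra.smul_def, hc_smul] at h ⊢
    rw [← h.tsum_eq, h.summable.tsum_eq_zero_add, h0, mul_zero, zero_add]
    simp only [hs, pow_succ']
  induction a using Polynomial.induction_on generalizing ℓ with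
  | C s =>
    rw [hc_C, ← tsum_mul_left]
    refine tsum_congr fun j => ?_
    rw [C_mul', map_smul, smul_eq_mul, Algebra.smul_def, Algebra.smul_def, map_mul, mul_assoc]
  | add a b ha hb =>
    rw [hc_add, ha, hb, ← Summable.tsum_add]
    · simp only [add_mul, map_add, add_smul]
    · exact summable_functional_smul hw (ℓ ∘ₗ LinearMap.mulLeft 𝔽 a)
    · exact summable_functional_smul hw (ℓ ∘ₗ LinearMap.mulLeft 𝔽 b)
  | monomial n s ih =>
    have hrw : C s * X ^ (n + 1) = X * (C s * X ^ n) := by ring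
    rw [pow_succ, ← mul_assoc, hc_mul, hX]
    refine (ih (ℓ ∘ₗ LinearMap.mulLeft 𝔽 X)).trans (tsum_congr fun j => ?_)
    simp only [LinearMap.comp_apply, LinearMap.mulLeft_apply]
    congr 2
    ring

/-- The `n`-th hyperderivative of `∑ w_i z ^ i` at a root `z` of a monic polynomial `f` over `𝔽`,
in terms of the powers `z ^ i` with `i < deg f`. -/
theorem hyperderivative_eq_sum {𝔽 L : Type*} [Field 𝔽] [Finite 𝔽] [NormedField L]
    [IsUltrametricDist L] [CompleteSpace L] [Algebra 𝔽 L] {w : ℕ → L}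
    (hw : Tendsto w atTop (𝓝 0)) {f : 𝔽[X]} (hf : f.Monic) (hf0 : 0 < f.natDegree) {z : L}
    (hz : aeval z f = 0) {n : ℕ} {y : L}
    (hy : HasSum (fun i : ℕ => ((i + n).choose n : L) * w (i + n) * z ^ i) y) :
    y = ∑ i ∈ Finset.range f.natDegree,
      (∑' j, (lcoeff 𝔽 i ∘ₗ modByMonicHom f ∘ₗ hasseDeriv n) (X ^ j) • w j) * z ^ i := by
  have h1 := hasSum_sum (s := Finset.range f.natDegree) fun i _ =>
    (summable_functional_smul hw
      (lcoeff 𝔽 i ∘ₗ modByMonicHom f ∘ₗ hasseDeriv n)).hasSum.mul_right (z ^ i)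
  have hterm : ∀ j, ∑ i ∈ Finset.range f.natDegree,
      (lcoeff 𝔽 i ∘ₗ modByMonicHom f ∘ₗ hasseDeriv n) (X ^ j) • w j * z ^ i =
      (j.choose n : L) * w j * z ^ (j - n) := by
    intro j
    have h : aeval z (hasseDeriv n (X ^ j : 𝔽[X]) %ₘ f) = (j.choose n : L) * z ^ (j - n) := by
      rw [aeval_modByMonic_eq_self_of_root hz, ← monomial_one_right_eq_X_pow, hasseDeriv_monomial,
        aeval_monomial]
      simp
    rw [aeval_eq_sum_range' (natDegree_modByMonic_lt _ hf (by rintro rfl; simp at hf0))] at h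
    rw [mul_right_comm, ← h, Finset.sum_mul]
    refine Finset.sum_congr rfl fun i _ => ?_
    simp only [LinearMap.comp_apply, lcoeff_apply, modByMonicHom_apply, Algebra.smul_def]
    ring
  simp only [hterm] at h1
  refine hy.unique ?_
  rw [← (add_left_injective n).hasSum_iff] at h1
  · simpa [Function.comp_def] using h1
  · intro j hj
    have : j < n := by
      by_contra! h
      exact hj ⟨j - n, Nat.sub_add_cancel h⟩
    simp [Nat.choose_eq_zero_of_lt this]


/-- Integrality of `ω^{(n)}(ζ)`.
In the Carlitz/Anderson–Thakur setting (`L` an algebraically closed complete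
nonarchimedean valued extension of `K = 𝔽_q(θ)` with `‖θ‖ = q`, `ω` the
Anderson–Thakur function with Taylor coefficients `w`, `Ω n` its `n`-th
hyperderivative, `𝔠` the Carlitz module, `𝔭` a monic irreducible of degree `d`
with root `ζ`), write `ω^{(n)}(ζ_k) = ∑_{i=0}^{d-1} c_{(n),i} ζ_k^i` for all
conjugates `ζ_k = ζ^{q^{k}}`.  Then each `c_{(n),i}` is Carlitz `𝔭^{n+1}`-torsion;
hence `ω^{(n)}(ζ) ∈ A_n[ζ]` (with `A_n` the integral closure of `A` in the subfield
of `L` generated over `K` by `C[𝔭^{n+1}]`), and in particular `ω^{(n)}(ζ)` is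
integral over `A[ζ]`. -/
theorem stmt_7 {L : Type*} [NormedField L] [CompleteSpace L] [IsAlgClosed L]
    (hna : IsNonarchimedean (fun x : L => ‖x‖))
    (p q κ : ℕ) (hp : p.Prime) (hκ : 0 < κ) (hq : q = p ^ κ)
    (𝔽 : Type*) [Field 𝔽] [Fintype 𝔽] [Algebra 𝔽 L] (hcard : Fintype.card 𝔽 = q)
    (θ : L) (hθ : ‖θ‖ = q)
    (𝔠 : Polynomial 𝔽 → L → L)
    (hc_add : ∀ a b : Polynomial 𝔽, ∀ x : L, 𝔠 (a + b) x = 𝔠 a x + 𝔠 b x)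
    (hc_mul : ∀ a b : Polynomial 𝔽, ∀ x : L, 𝔠 (a * b) x = 𝔠 a (𝔠 b x))
    (hc_C : ∀ (s : 𝔽) (x : L), 𝔠 (Polynomial.C s) x = algebraMap 𝔽 L s * x)
    (hc_X : ∀ x : L, 𝔠 Polynomial.X x = x ^ q + θ * x)
    (hc_lin : ∀ (a : Polynomial 𝔽) (x y : L), 𝔠 a (x + y) = 𝔠 a x + 𝔠 a y)
    (hc_smul : ∀ (a : Polynomial 𝔽) (s : 𝔽) (x : L),
      𝔠 a (algebraMap 𝔽 L s * x) = algebraMap 𝔽 L s * 𝔠 a x)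
    (lamθ : L) (hlamθ : lamθ ^ (q - 1) = -θ)
    (w : ℕ → L) (hw0 : Filter.Tendsto (fun i => ‖w i‖) Filter.atTop (nhds 0))
    (hωdef : ∀ z : L, ‖z‖ ≤ 1 → ∃ P : L,
      HasProd (fun j : ℕ => (1 - z / θ ^ q ^ j)⁻¹) P ∧
      HasSum (fun i : ℕ => w i * z ^ i) (lamθ * P))
    (Ω : ℕ → L → L)
    (hΩ : ∀ (n : ℕ) (z : L), ‖z‖ ≤ 1 →
      HasSum (fun i : ℕ => ((i + n).choose n : L) * w (i + n) * z ^ i) (Ω n z))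
    (d : ℕ) (hd : 0 < d)
    (𝔭 : Polynomial 𝔽) (hmonic : 𝔭.Monic) (hirr : Irreducible 𝔭)
    (hdeg : 𝔭.natDegree = d)
    (ζ : L) (hζ : Polynomial.aeval ζ 𝔭 = 0)
    (c : ℕ → ℕ → L)
    (hcV : ∀ (n : ℕ) (k : ℕ), k < d →
      Ω n (ζ ^ q ^ k) = ∑ i ∈ Finset.range d, c n i * (ζ ^ q ^ k) ^ i) :
    ∀ n : ℕ,
      (∀ i < d, 𝔠 (𝔭 ^ (n + 1)) (c n i) = 0) ∧
      Ω n ζ ∈ Subring.closure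
        ({x : L | x ∈ Subfield.closure
            (Set.range (algebraMap 𝔽 L) ∪ {θ} ∪ {y : L | 𝔠 (𝔭 ^ (n + 1)) y = 0}) ∧
          IsIntegral (Subring.closure (Set.range (algebraMap 𝔽 L) ∪ {θ})) x} ∪ {ζ}) ∧
      IsIntegral (Subring.closure (Set.range (algebraMap 𝔽 L) ∪ {θ, ζ})) (Ω n ζ) := by
  have hqcard : 1 < q := hcard ▸ Fintype.one_lt_card
  have hθ1 : 1 < ‖θ‖ := by rw [hθ]; exact_mod_cast hqcard
  have : IsUltrametricDist L := IsUltrametricDist.isUltrametricDist_of_isNonarchimedean_norm hna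
  have hw : Tendsto w atTop (𝓝 0) := tendsto_zero_iff_norm_tendsto_zero.2 hw0
  obtain ⟨hrec0, hrec⟩ := andersonThakur_coeff 𝔽 hcard hθ1 hlamθ hωdef
  have hcont : Continuous (𝔠 X) := by
    rw [show 𝔠 X = fun x => x ^ q + θ * x from funext hc_X]
    fun_prop
  have hroot : ∀ k, aeval (ζ ^ q ^ k) 𝔭 = 0 := by
    intro k
    have h : (FiniteField.frobeniusAlgHom 𝔽 L ^ k) ζ = ζ ^ q ^ k := by
      rw [AlgHom.coe_pow, FiniteField.coe_frobeniusAlgHom, pow_iterate, hcard]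
    rw [← h, aeval_algHom_apply, hζ, map_zero]
  subst hdeg
  intro n
  have htors : ∀ i < 𝔭.natDegree, 𝔠 (𝔭 ^ (n + 1)) (c n i) = 0 := by
    intro i hi
    have hinj := injOn_pow_card_pow_of_irreducible hirr hζ
    rw [hcard] at hinj
    rw [eq_of_sum_mul_pow_eq (b := c n) (c := fun i =>
      ∑' j, (lcoeff 𝔽 i ∘ₗ modByMonicHom 𝔭 ∘ₗ hasseDeriv n) (X ^ j) • w j) hinj
      (fun k => ?_) i hi, carlitz_tsum_functional_smul hc_add hc_mul hc_C hcont (hc_lin X)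
        (hc_smul X) hw (by rw [hc_X, hrec0]) (fun i => by rw [hc_X, hrec])]
    · have h0 : ∀ j, (lcoeff 𝔽 i ∘ₗ modByMonicHom 𝔭 ∘ₗ hasseDeriv n) (𝔭 ^ (n + 1) * X ^ j) = 0 := by
        intro j
        have := (modByMonic_eq_zero_iff_dvd hmonic).2
          (dvd_hasseDeriv_of_pow_succ_dvd n (dvd_mul_right (𝔭 ^ (n + 1)) (X ^ j)) le_rfl)
        simp only [LinearMap.comp_apply, modByMonicHom_apply, this, map_zero]
      simp only [h0, zero_smul, tsum_zero]
    · rw [← hcV n k k.2]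
      exact hyperderivative_eq_sum hw hmonic hd (hroot k) (hΩ n _
        (norm_le_one_of_isIntegral_finite ⟨𝔭, hmonic, hroot k⟩))
  have hint : ∀ {S : Subring L}, (∀ s : 𝔽, algebraMap 𝔽 L s ∈ S) → θ ∈ S →
      ∀ i < 𝔭.natDegree, IsIntegral S (c n i) := fun hS hθS i hi =>
    isIntegral_of_carlitz_torsion hqcard hc_add hc_mul hc_C hc_X hS hθS (hmonic.pow _) (htors i hi)
  have hΩζ : Ω n ζ = ∑ i ∈ Finset.range 𝔭.natDegree, c n i * ζ ^ i := by
    simpa using hcV n 0 hd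
  refine ⟨htors, ?_, ?_⟩
  · rw [hΩζ]
    refine sum_mem fun i hi => mul_mem (Subring.subset_closure (Or.inl ⟨?_, ?_⟩)) (pow_mem ?_ _)
    · exact Subfield.subset_closure (Or.inr (htors i (Finset.mem_range.1 hi)))
    · exact hint (fun s => Subring.subset_closure (Or.inl ⟨s, rfl⟩))
        (Subring.subset_closure (Or.inr (Set.mem_singleton θ))) i (Finset.mem_range.1 hi)
    · exact Subring.subset_closure (Or.inr rfl)
  · rw [hΩζ]
    refine IsIntegral.sum _ fun i hi => (hint (fun s => Subring.subset_closure (Or.inl ⟨s, rfl⟩))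
      (Subring.subset_closure (Or.inr (Or.inl rfl))) i (Finset.mem_range.1 hi)).mul
        (IsIntegral.pow ?_ _)
    exact isIntegral_algebraMap (A := L) (x := (⟨ζ, Subring.subset_closure (Or.inr (Or.inr rfl))⟩ :
      Subring.closure (Set.range (algebraMap 𝔽 L) ∪ {θ, ζ})))
end

section
/- Fix n ≥ 1, and let 𝔮_{(n)}(θ,T) := ∑_{j=1}^d 𝔭'(ζ_j)^{−1}·(𝔭(θ)/(θ − ζ_j))^{n+1}·(𝔭(T)/(T − ζ_j)) ∈ E[θ,T], which is the unique polynomial of degree < d in T with 𝔮_{(n)}(θ,ζ_k) = (𝔭(θ)/(θ − ζ_k))^{n+1} for all k = 1,…,d. Then: (a) all coefficients of 𝔮_{(n)} lie in k[θ]; and (b) 𝔮_{(n)}(θ,T) ≡ ((𝔭(θ) − 𝔭(T))/(θ − T))^{n+1} (mod 𝔭(T)) in E[θ,T], where (𝔭(θ) − 𝔭(T))/(θ − T) is the exact polynomial quotient. -/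
open Polynomial in
/-- Dividing `f` by `X - C a` at a root `a` and evaluating at a root `b` gives `f'(a)` if `a = b`
and `0` otherwise. -/
theorem eval_divByMonic_X_sub_C_of_isRoot {F : Type*} [Field F] [DecidableEq F] {f : F[X]} {a b : F}
    (ha : f.IsRoot a) (hb : f.IsRoot b) :
    (f /ₘ (X - C a)).eval b = if a = b then f.derivative.eval a else 0 := by
  have h := mul_divByMonic_eq_iff_isRoot.mpr ha
  split_ifs with hab
  · subst hab
    have h' := congrArg (fun g => g.derivative.eval a) h
    simpa [derivative_mul] using h'
  · have h' := congrArg (eval b) h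
    rw [eval_mul, hb.eq_zero] at h'
    exact (mul_eq_zero.mp h').resolve_left (by simpa [sub_eq_zero] using Ne.symm hab)

open Polynomial in
/-- The difference quotient of `f` satisfies `(T - θ) * Q = f(T) - f(θ)`. -/
theorem X_sub_C_X_mul_divByMonic {R : Type*} [CommRing R] [IsDomain R] (f : R[X]) :
    (X - C X) * ((f.map C - C f) /ₘ (X - C X)) = f.map C - C f := by
  refine mul_divByMonic_eq_iff_isRoot.mpr ?_
  simp [IsRoot.def, eval_map, eval₂_C_X]

open Polynomial in
/-- The difference quotient of `f` specialised at a root `a` is `f / (X - a)`. -/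
theorem eval_C_divByMonic_X_sub_C_X {F : Type*} [Field F] {f : F[X]} {a : F} (ha : f.IsRoot a) :
    ((f.map C - C f) /ₘ (X - C X)).eval (C a) = f /ₘ (X - C a) := by
  have h := congrArg (eval (C a)) (X_sub_C_X_mul_divByMonic f)
  have h' := mul_divByMonic_eq_iff_isRoot.mpr ha
  have hz : eval (C a) (f.map C) = 0 := by
    rw [eval_map, eval₂_at_apply, ha.eq_zero, C_0]
  simp only [eval_mul, eval_sub, eval_X, eval_C, hz] at h
  refine mul_left_cancel₀ (X_sub_C_ne_zero a) ?_
  linear_combination -h - h'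


open Polynomial in
/-- Let `k` be a field and `𝔭 ∈ k[X]` monic separable of degree
`d ≥ 1` with distinct roots `ζ_1, …, ζ_d` in a splitting field `E`.  Fix `n ≥ 1` and
set, in `E[θ][T]`,
`𝔮_{(n)}(θ,T) := ∑_j 𝔭'(ζ_j)⁻¹ · (𝔭(θ)/(θ-ζ_j))^{n+1} · (𝔭(T)/(T-ζ_j))`,
which is the unique polynomial of degree `< d` in `T` with
`𝔮_{(n)}(θ,ζ_k) = (𝔭(θ)/(θ-ζ_k))^{n+1}` for all `k`.  Then (a) all coefficients of
`𝔮_{(n)}` lie in `k[θ]`, and (b) `𝔮_{(n)}(θ,T) ≡ ((𝔭(θ)-𝔭(T))/(θ-T))^{n+1}`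
modulo `𝔭(T)` in `E[θ,T]`, where `(𝔭(θ)-𝔭(T))/(θ-T)` is the exact polynomial
quotient. -/
theorem stmt_10 {k E : Type*} [Field k] [Field E] [Algebra k E]
    (d : ℕ) (hd : 0 < d)
    (𝔭 : k[X]) (hmonic : 𝔭.Monic) (hdeg : 𝔭.natDegree = d) (hsep : 𝔭.Separable)
    (ζ : Fin d → E) (hinj : Function.Injective ζ)
    (hsplit : 𝔭.map (algebraMap k E) = ∏ j : Fin d, (X - C (ζ j)))
    (n : ℕ) (hn : 1 ≤ n) :
    let P : E[X] := 𝔭.map (algebraMap k E)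
    let Q : Polynomial E[X] :=
      (P.map Polynomial.C - Polynomial.C P) /ₘ (Polynomial.X - Polynomial.C Polynomial.X)
    let 𝔮 : Polynomial E[X] :=
      ∑ j : Fin d,
        Polynomial.C (Polynomial.C ((P.derivative.eval (ζ j))⁻¹) *
            (P /ₘ (X - C (ζ j))) ^ (n + 1)) *
          ((P.map Polynomial.C) /ₘ (X - Polynomial.C (Polynomial.C (ζ j))))
    𝔮.degree < (d : ℕ) ∧
    (∀ j : Fin d,
      Polynomial.eval (Polynomial.C (ζ j)) 𝔮 = (P /ₘ (X - C (ζ j))) ^ (n + 1)) ∧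
    (∀ r : Polynomial E[X], r.degree < (d : ℕ) →
      (∀ j : Fin d,
        Polynomial.eval (Polynomial.C (ζ j)) r = (P /ₘ (X - C (ζ j))) ^ (n + 1)) →
      r = 𝔮) ∧
    (∀ i : ℕ, ∃ r : k[X], 𝔮.coeff i = r.map (algebraMap k E)) ∧
    ∃ h : Polynomial E[X], 𝔮 - Q ^ (n + 1) = (P.map Polynomial.C) * h := by
  intro P Q 𝔮
  classical
  have hPm : P.Monic := hmonic.map _
  have hPdeg : P.degree = d := by
    rw [degree_eq_natDegree hPm.ne_zero, hmonic.natDegree_map, hdeg]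
  have hroot (j : Fin d) : P.IsRoot (ζ j) := by
    rw [IsRoot.def, show P = _ from hsplit, eval_prod]
    exact Finset.prod_eq_zero (Finset.mem_univ j) (by simp)
  have hder (j : Fin d) : P.derivative.eval (ζ j) ≠ 0 := by
    have h : P.Separable := hsep.map
    simpa using h.aeval_derivative_ne_zero (x := ζ j) (by simpa using (hroot j).eq_zero)
  have hquot (j : Fin d) : P.map C /ₘ (X - C (C (ζ j))) = (P /ₘ (X - C (ζ j))).map C := by
    rw [map_divByMonic _ (monic_X_sub_C _)]; simp
  have hq_deg : 𝔮.degree < (d : ℕ) := by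
    refine (degree_sum_le _ _).trans_lt ((Finset.sup_lt_iff (WithBot.bot_lt_coe d)).mpr ?_)
    intro j _
    rw [hquot, ← smul_eq_C_mul]
    refine (degree_smul_le _ _).trans_lt (degree_map_le.trans_lt ?_)
    exact (degree_divByMonic_lt _ _ hPm.ne_zero (by simp)).trans_eq hPdeg
  have hq_eval (j : Fin d) : eval (C (ζ j)) 𝔮 = (P /ₘ (X - C (ζ j))) ^ (n + 1) := by
    have hterm (i : Fin d) : eval (C (ζ j)) (P.map C /ₘ (X - C (C (ζ i)))) =
        if i = j then C (P.derivative.eval (ζ i)) else 0 := by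
      rw [hquot, eval_map, eval₂_at_apply,
        eval_divByMonic_X_sub_C_of_isRoot (hroot i) (hroot j)]
      simp only [hinj.eq_iff]
      split_ifs <;> simp
    simp only [𝔮, eval_finsetSum, eval_mul, eval_C, hterm, mul_ite, mul_zero,
      Finset.sum_ite_eq', Finset.mem_univ, if_true]
    rw [mul_right_comm, ← C_mul, inv_mul_cancel₀ (hder j), C_1, one_mul]
  have huniq (r : Polynomial E[X]) (hr : r.degree < (d : ℕ))
      (he : ∀ j, eval (C (ζ j)) r = (P /ₘ (X - C (ζ j))) ^ (n + 1)) : r = 𝔮 := by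
    refine eq_of_degrees_lt_of_eval_index_eq (v := fun j => C (ζ j)) Finset.univ
      (C_injective.comp hinj).injOn ?_ ?_ fun j _ => (he j).trans (hq_eval j).symm
    · simpa using hr
    · simpa using hq_deg
  have hPCm : (P.map C).Monic := hPm.map _
  have hrem : Q ^ (n + 1) %ₘ P.map C = 𝔮 := by
    refine huniq _ ?_ fun j => ?_
    · refine (degree_modByMonic_lt _ hPCm).trans_eq ?_
      rw [degree_map_eq_of_injective C_injective, hPdeg]
    · have hz : eval (C (ζ j)) (P.map C) = 0 := by
        rw [eval_map, eval₂_at_apply, (hroot j).eq_zero, C_0]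
      have h := congrArg (eval (C (ζ j))) (modByMonic_add_div (Q ^ (n + 1)) (P.map C))
      rw [eval_add, eval_mul, hz, zero_mul, add_zero, eval_pow,
        eval_C_divByMonic_X_sub_C_X (hroot j)] at h
      exact h
  refine ⟨hq_deg, hq_eval, huniq, fun i => ?_, -(Q ^ (n + 1) /ₘ P.map C), ?_⟩
  · let φ : k[X] →+* E[X] := mapRingHom (algebraMap k E)
    let Q₀ : Polynomial k[X] := (𝔭.map C - C 𝔭) /ₘ (X - C X)
    have hmapC : (𝔭.map C).map φ = P.map C := by
      simp only [P, φ, Polynomial.map_map]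
      congr 1
      ext <;> simp
    have hQ : Q₀.map φ = Q := by
      simp only [Q₀, Q]
      rw [map_divByMonic _ (monic_X_sub_C _), Polynomial.map_sub, hmapC]
      simp [φ, P]
    refine ⟨(Q₀ ^ (n + 1) %ₘ 𝔭.map C).coeff i, ?_⟩
    rw [← hrem, ← hQ, ← hmapC, ← Polynomial.map_pow, ← map_modByMonic _ (hmonic.map _), coeff_map]
    rfl
  · rw [← hrem]
    linear_combination modByMonic_add_div (Q ^ (n + 1)) (P.map C)
end

section
/- For every n ≥ 0 and every i = 0,…,d−1, one has c_{(n),i} = exp_C(π̃·𝔮_{(n),i}/𝔭^{n+1}) = 𝔠_{𝔮_{(n),i}}(exp_C(π̃/𝔭^{n+1})). -/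
open Polynomial in
/-- If `ζ` is a root of an irreducible polynomial `f` over a finite field with `q` elements, then
`ζ ^ q ^ n = ζ` exactly when `deg f ∣ n`. -/
theorem Irreducible.pow_card_pow_eq_self_iff {𝔽 L : Type*} [Field 𝔽] [Fintype 𝔽] [Field L]
    [Algebra 𝔽 L] {f : 𝔽[X]} (hf : Irreducible f) {ζ : L} (hζ : aeval ζ f = 0) (n : ℕ) :
    ζ ^ Fintype.card 𝔽 ^ n = ζ ↔ f.natDegree ∣ n := by
  rw [hf.natDegree_dvd_iff_dvd_X_pow_card_pow_sub_X, Nat.card_eq_fintype_card,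
    ← hf.dvd_iff_aeval_eq_zero hζ]
  simp [sub_eq_zero]

namespace FiniteField

section Frobenius

variable (𝔽 : Type*) {L : Type*} [Field 𝔽] [Fintype 𝔽] [Field L] [Algebra 𝔽 L]

theorem frobeniusAlgHom_pow_apply (m : ℕ) (x : L) :
    (frobeniusAlgHom 𝔽 L ^ m) x = x ^ Fintype.card 𝔽 ^ m := by
  rw [AlgHom.coe_pow, coe_frobeniusAlgHom, pow_iterate]

theorem add_pow_card_pow (m : ℕ) (x y : L) :
    (x + y) ^ Fintype.card 𝔽 ^ m = x ^ Fintype.card 𝔽 ^ m + y ^ Fintype.card 𝔽 ^ m := by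
  simp only [← frobeniusAlgHom_pow_apply, map_add]

theorem algebraMap_pow_card_pow (m : ℕ) (s : 𝔽) :
    algebraMap 𝔽 L s ^ Fintype.card 𝔽 ^ m = algebraMap 𝔽 L s := by
  rw [← frobeniusAlgHom_pow_apply, AlgHom.commutes]

theorem pow_card_pow_injective (m : ℕ) :
    Function.Injective fun x : L => x ^ Fintype.card 𝔽 ^ m := by
  intro x y h
  simp only [← frobeniusAlgHom_pow_apply] at h
  exact (frobeniusAlgHom 𝔽 L ^ m).injective h

variable {𝔽}

omit [Field 𝔽] [Algebra 𝔽 L] in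
theorem pow_card_pow_add_mul {ζ : L} {d : ℕ} (hζ : ζ ^ Fintype.card 𝔽 ^ d = ζ) (k r : ℕ) :
    ζ ^ Fintype.card 𝔽 ^ (k + d * r) = ζ ^ Fintype.card 𝔽 ^ k := by
  induction r with
  | zero => simp
  | succ r ih =>
    rw [← ih, show k + d * (r + 1) = d + (k + d * r) by ring, pow_add _ d, pow_mul, hζ]

open Polynomial in
/-- The conjugates `ζ ^ q ^ k`, `k < deg f`, of a root of an irreducible `f` are distinct. -/
theorem injOn_pow_card_pow {f : 𝔽[X]} (hf : Irreducible f) {ζ : L} (hζ : aeval ζ f = 0) :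
    Set.InjOn (fun k => ζ ^ Fintype.card 𝔽 ^ k) (Finset.range f.natDegree) := by
  have key : ∀ a b : ℕ, a ≤ b → b < f.natDegree →
      ζ ^ Fintype.card 𝔽 ^ a = ζ ^ Fintype.card 𝔽 ^ b → a = b := by
    intro a b hab hb h
    have h' : f.natDegree ∣ b - a := by
      rw [← hf.pow_card_pow_eq_self_iff hζ]
      apply pow_card_pow_injective 𝔽 a
      simp only [← pow_mul, ← pow_add, Nat.sub_add_cancel hab, h]
    have := Nat.eq_zero_of_dvd_of_lt h' (by omega)
    omega
  intro a ha b hb h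
  simp only [Finset.coe_range, Set.mem_Iio] at ha hb
  rcases le_total a b with hab | hab
  · exact key a b hab hb h
  · exact (key b a hab ha h.symm).symm

open Polynomial in
theorem sub_mul_eval_divByMonic {f : 𝔽[X]} {ζ : L} (hζ : aeval ζ f = 0) (k : ℕ) (θ : L) :
    (θ - ζ ^ Fintype.card 𝔽 ^ k) *
      eval θ ((f.map (algebraMap 𝔽 L)) /ₘ (X - C (ζ ^ Fintype.card 𝔽 ^ k))) = aeval θ f := by
  have h : (f.map (algebraMap 𝔽 L)).IsRoot (ζ ^ Fintype.card 𝔽 ^ k) := by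
    rw [IsRoot.def, eval_map_algebraMap, ← frobeniusAlgHom_pow_apply, aeval_algHom_apply, hζ,
      map_zero]
  simpa [eval_map_algebraMap] using congrArg (eval θ) (mul_divByMonic_eq_iff_isRoot.mpr h)

/-- Frobenius twists of the interpolation identity
`∑ i, a i * ζ_k ^ i = (P / (θ - ζ_k)) ^ N` at the conjugates `ζ_k = ζ ^ q ^ k`. -/
theorem sum_div_pow_card_pow_mul_pow {ζ θ P : L} {d N : ℕ} (hd : 0 < d)
    (hζ : ζ ^ Fintype.card 𝔽 ^ d = ζ) (hP : P ≠ 0) {a : ℕ → L}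
    (ha : ∀ k < d, (θ - ζ ^ Fintype.card 𝔽 ^ k) ^ N *
      ∑ i ∈ Finset.range d, a i * (ζ ^ Fintype.card 𝔽 ^ k) ^ i = P ^ N)
    (m k : ℕ) (hne : θ ^ Fintype.card 𝔽 ^ m - ζ ^ Fintype.card 𝔽 ^ k ≠ 0) :
    ∑ i ∈ Finset.range d, (a i / P ^ N) ^ Fintype.card 𝔽 ^ m * (ζ ^ Fintype.card 𝔽 ^ k) ^ i =
      1 / (θ ^ Fintype.card 𝔽 ^ m - ζ ^ Fintype.card 𝔽 ^ k) ^ N := by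
  obtain ⟨j, hj, hjk⟩ : ∃ j < d, (ζ ^ Fintype.card 𝔽 ^ j) ^ Fintype.card 𝔽 ^ m =
      ζ ^ Fintype.card 𝔽 ^ k := by
    refine ⟨(k + m * (d - 1)) % d, Nat.mod_lt _ hd, ?_⟩
    rw [← pow_card_pow_add_mul hζ _ ((k + m * (d - 1)) / d), Nat.mod_add_div, ← pow_mul,
      ← pow_add, ← pow_card_pow_add_mul hζ k m]
    congr 2
    obtain ⟨e, rfl⟩ := Nat.exists_eq_add_of_le' hd
    simp only [Nat.add_sub_cancel]
    ring
  have h := congrArg (frobeniusAlgHom 𝔽 L ^ m) (ha j hj)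
  simp only [map_mul, map_pow, map_sum, map_sub] at h
  rw [← map_pow, frobeniusAlgHom_pow_apply 𝔽 m (ζ ^ _), hjk] at h
  rw [← frobeniusAlgHom_pow_apply 𝔽 m θ] at hne ⊢
  simp only [← frobeniusAlgHom_pow_apply 𝔽 m (a _ / _), map_div₀, map_pow]
  have hP' : (frobeniusAlgHom 𝔽 L ^ m) P ≠ 0 := (map_ne_zero _).mpr hP
  rw [eq_div_iff (pow_ne_zero _ hne), mul_comm]
  simp only [div_mul_eq_mul_div, ← Finset.sum_div]
  rw [← mul_div_assoc, h, div_self (pow_ne_zero _ hP')]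

end Frobenius

end FiniteField

open Polynomial in
/-- Coefficients of a polynomial of degree `< d` are determined by its values at `d` points. -/
theorem eq_of_sum_mul_pow_eq_s11 {L : Type*} [Field L] {d : ℕ} {v : ℕ → L}
    (hv : Set.InjOn v (Finset.range d)) {a b : ℕ → L}
    (h : ∀ k < d, ∑ i ∈ Finset.range d, a i * v k ^ i = ∑ i ∈ Finset.range d, b i * v k ^ i)
    {i : ℕ} (hi : i < d) : a i = b i := by
  have hdeg : ∀ a : ℕ → L, (∑ i ∈ Finset.range d, C (a i) * X ^ i : L[X]).degree <
      (Finset.range d).card := by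
    intro a
    rw [Finset.card_range, Polynomial.degree_lt_iff_coeff_zero]
    intro m hm
    simp only [finsetSum_coeff, coeff_C_mul_X_pow]
    exact Finset.sum_eq_zero fun j hj => if_neg (by have := Finset.mem_range.mp hj; omega)
  have := Polynomial.eq_of_degrees_lt_of_eval_index_eq _ hv (hdeg a) (hdeg b) fun k hk => by
    simpa [Polynomial.eval_finsetSum] using h k (Finset.mem_range.mp hk)
  simpa [Polynomial.finsetSum_coeff, Polynomial.coeff_C_mul_X_pow, hi] using
    congrArg (Polynomial.coeff · i) this

section NormedField

variable {L : Type*} [NormedField L]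

theorem pow_ne_self_of_one_lt_norm {x : L} (hx : 1 < ‖x‖) {N : ℕ} (hN : 1 < N) : x ^ N ≠ x := by
  intro h
  have h' : ‖x‖ ^ 1 < ‖x‖ ^ N := pow_lt_pow_right₀ hx hN
  rw [← norm_pow x N, h, pow_one] at h'
  exact lt_irrefl _ h'

theorem norm_le_one_of_pow_eq_self {x : L} {N : ℕ} (hN : 1 < N) (h : x ^ N = x) : ‖x‖ ≤ 1 :=
  not_lt.mp fun hx => pow_ne_self_of_one_lt_norm hx hN h

end NormedField

namespace CarlitzModule

variable {𝔽 L : Type*} [Field 𝔽] [Fintype 𝔽] [NormedField L] [Algebra 𝔽 L]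

theorem factorial_ne_zero {q : ℕ} (hq : 1 < q) {θ : L} (hθ : 1 < ‖θ‖) {D : ℕ → L} (hD0 : D 0 = 1)
    (hDrec : ∀ m : ℕ, D (m + 1) = (θ ^ q ^ (m + 1) - θ) * D m ^ q) (m : ℕ) : D m ≠ 0 := by
  induction m with
  | zero => simp [hD0]
  | succ m ih =>
    rw [hDrec]
    exact mul_ne_zero (sub_ne_zero.mpr (pow_ne_self_of_one_lt_norm hθ
      (Nat.one_lt_pow m.succ_ne_zero hq))) (pow_ne_zero _ ih)

variable {D : ℕ → L} {expC : L → L}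

theorem exp_add (hexp : ∀ z : L, HasSum (fun m : ℕ => z ^ Fintype.card 𝔽 ^ m / D m) (expC z))
    (x y : L) : expC (x + y) = expC x + expC y := by
  refine (hexp (x + y)).unique ?_
  simpa only [FiniteField.add_pow_card_pow, add_div] using (hexp x).add (hexp y)

theorem exp_algebraMap_mul
    (hexp : ∀ z : L, HasSum (fun m : ℕ => z ^ Fintype.card 𝔽 ^ m / D m) (expC z))
    (s : 𝔽) (x : L) : expC (algebraMap 𝔽 L s * x) = algebraMap 𝔽 L s * expC x := by
  refine (hexp _).unique ?_
  simpa only [mul_pow, FiniteField.algebraMap_pow_card_pow, mul_div_assoc] using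
    (hexp x).mul_left (algebraMap 𝔽 L s)

theorem exp_theta_mul {θ : L} (hθ : 1 < ‖θ‖) (hD0 : D 0 = 1)
    (hDrec : ∀ m : ℕ, D (m + 1) =
      (θ ^ Fintype.card 𝔽 ^ (m + 1) - θ) * D m ^ Fintype.card 𝔽)
    (hexp : ∀ z : L, HasSum (fun m : ℕ => z ^ Fintype.card 𝔽 ^ m / D m) (expC z))
    (x : L) : expC (θ * x) = expC x ^ Fintype.card 𝔽 + θ * expC x := by
  have hD := factorial_ne_zero Fintype.one_lt_card hθ hD0 hDrec
  have h1 : HasSum (fun m : ℕ => (x ^ Fintype.card 𝔽 ^ m / D m) ^ Fintype.card 𝔽)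
      (expC x ^ Fintype.card 𝔽) :=
    (hexp x).map (FiniteField.frobeniusAlgHom 𝔽 L) (continuous_pow (Fintype.card 𝔽))
  have h2 : HasSum (fun m : ℕ => (θ ^ Fintype.card 𝔽 ^ m - θ) * (x ^ Fintype.card 𝔽 ^ m / D m))
      (expC x ^ Fintype.card 𝔽) := by
    rw [← hasSum_nat_add_iff' 1]
    simp only [Finset.sum_range_one, pow_zero, pow_one, sub_self, zero_mul, sub_zero]
    refine h1.congr_fun fun m => ?_
    have hm : θ ^ Fintype.card 𝔽 ^ (m + 1) - θ ≠ 0 := fun h => hD (m + 1) (by simp [hDrec, h])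
    rw [hDrec, div_pow, ← pow_mul, ← pow_succ, mul_div_assoc', mul_div_mul_left _ _ hm]
  refine (hexp _).unique ?_
  refine (h2.add ((hexp x).mul_left θ)).congr_fun fun m => ?_
  ring

open Polynomial in
/-- The Carlitz exponential intertwines multiplication by `a(θ)` with the Carlitz action of `a`. -/
theorem exp_aeval_mul {θ : L} {𝔠 : 𝔽[X] → L → L}
    (hc_add : ∀ a b : 𝔽[X], ∀ x : L, 𝔠 (a + b) x = 𝔠 a x + 𝔠 b x)
    (hc_mul : ∀ a b : 𝔽[X], ∀ x : L, 𝔠 (a * b) x = 𝔠 a (𝔠 b x))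
    (hc_C : ∀ (s : 𝔽) (x : L), 𝔠 (C s) x = algebraMap 𝔽 L s * x)
    (hc_X : ∀ x : L, 𝔠 X x = x ^ Fintype.card 𝔽 + θ * x)
    (hadd : ∀ x y : L, expC (x + y) = expC x + expC y)
    (hsmul : ∀ (s : 𝔽) (x : L), expC (algebraMap 𝔽 L s * x) = algebraMap 𝔽 L s * expC x)
    (htheta : ∀ x : L, expC (θ * x) = expC x ^ Fintype.card 𝔽 + θ * expC x)
    (a : 𝔽[X]) (x : L) : expC (aeval θ a * x) = 𝔠 a (expC x) := by
  induction a using Polynomial.induction_on generalizing x with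
  | C s => rw [aeval_C, hsmul, hc_C]
  | add f g hf hg => rw [map_add, add_mul, hadd, hf, hg, hc_add]
  | monomial n s ih =>
    rw [pow_succ, ← mul_assoc, map_mul, aeval_X, mul_assoc, ih, htheta, hc_mul _ X, hc_X]

end CarlitzModule


/-- Explicit torsion description of the coefficients of
`ω^{(n)}(ζ)`.  In the Carlitz/Anderson–Thakur setting, with `D_m` the Carlitz
factorials, `exp_C` the Carlitz exponential, `π̃` the fundamental period, and assuming
Pellarin's identity `ω^{(n)}(z) = ∑_{m ≥ 0} π̃^{q^m}/(D_m (θ^{q^m} - z)^{n+1})`, write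
`ω^{(n)}(ζ_k) = ∑_{i=0}^{d-1} c_{(n),i} ζ_k^i` for the conjugates `ζ_k` of the root
`ζ` of the monic irreducible `𝔭`, and let `𝔮_{(n),i} ∈ A` be the `T`-coefficients of
the unique polynomial `𝔮_{(n)}(θ,T) ∈ A[T]` of degree `< d` in `T` with
`𝔮_{(n)}(θ,ζ_k) = (𝔭(θ)/(θ-ζ_k))^{n+1}` for all `k`.  Then for every `n ≥ 0` and
`0 ≤ i ≤ d-1`,
`c_{(n),i} = exp_C(π̃·𝔮_{(n),i}/𝔭^{n+1}) = 𝔠_{𝔮_{(n),i}}(exp_C(π̃/𝔭^{n+1}))`. -/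
theorem stmt_11 {L : Type*} [NormedField L] [CompleteSpace L] [IsAlgClosed L]
    (hna : IsNonarchimedean (fun x : L => ‖x‖))
    (p q κ : ℕ) (hp : p.Prime) (hκ : 0 < κ) (hq : q = p ^ κ)
    (𝔽 : Type*) [Field 𝔽] [Fintype 𝔽] [Algebra 𝔽 L] (hcard : Fintype.card 𝔽 = q)
    (θ : L) (hθ : ‖θ‖ = q)
    (𝔠 : Polynomial 𝔽 → L → L)
    (hc_add : ∀ a b : Polynomial 𝔽, ∀ x : L, 𝔠 (a + b) x = 𝔠 a x + 𝔠 b x)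
    (hc_mul : ∀ a b : Polynomial 𝔽, ∀ x : L, 𝔠 (a * b) x = 𝔠 a (𝔠 b x))
    (hc_C : ∀ (s : 𝔽) (x : L), 𝔠 (Polynomial.C s) x = algebraMap 𝔽 L s * x)
    (hc_X : ∀ x : L, 𝔠 Polynomial.X x = x ^ q + θ * x)
    (hc_lin : ∀ (a : Polynomial 𝔽) (x y : L), 𝔠 a (x + y) = 𝔠 a x + 𝔠 a y)
    (hc_smul : ∀ (a : Polynomial 𝔽) (s : 𝔽) (x : L),
      𝔠 a (algebraMap 𝔽 L s * x) = algebraMap 𝔽 L s * 𝔠 a x)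
    (lamθ : L) (hlamθ : lamθ ^ (q - 1) = -θ)
    (w : ℕ → L) (hw0 : Filter.Tendsto (fun i => ‖w i‖) Filter.atTop (nhds 0))
    (hωdef : ∀ z : L, ‖z‖ ≤ 1 → ∃ P : L,
      HasProd (fun j : ℕ => (1 - z / θ ^ q ^ j)⁻¹) P ∧
      HasSum (fun i : ℕ => w i * z ^ i) (lamθ * P))
    (Ω : ℕ → L → L)
    (hΩ : ∀ (n : ℕ) (z : L), ‖z‖ ≤ 1 →
      HasSum (fun i : ℕ => ((i + n).choose n : L) * w (i + n) * z ^ i) (Ω n z))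
    (D : ℕ → L) (hD0 : D 0 = 1)
    (hDrec : ∀ m : ℕ, D (m + 1) = (θ ^ q ^ (m + 1) - θ) * D m ^ q)
    (expC : L → L)
    (hexp : ∀ z : L, HasSum (fun m : ℕ => z ^ q ^ m / D m) (expC z))
    (π' : L)
    (hPell : ∀ (n : ℕ) (z : L), ‖z‖ ≤ 1 →
      HasSum (fun m : ℕ => π' ^ q ^ m / (D m * (θ ^ q ^ m - z) ^ (n + 1))) (Ω n z))
    (d : ℕ) (hd : 0 < d)
    (𝔭 : Polynomial 𝔽) (hmonic : 𝔭.Monic) (hirr : Irreducible 𝔭)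
    (hdeg : 𝔭.natDegree = d)
    (ζ : L) (hζ : Polynomial.aeval ζ 𝔭 = 0)
    (c : ℕ → ℕ → L)
    (hcV : ∀ (n : ℕ) (k : ℕ), k < d →
      Ω n (ζ ^ q ^ k) = ∑ i ∈ Finset.range d, c n i * (ζ ^ q ^ k) ^ i)
    (Qn : ℕ → Polynomial (Polynomial 𝔽))
    (hQdeg : ∀ n : ℕ, (Qn n).degree < (d : ℕ))
    (hQinterp : ∀ (n : ℕ) (k : ℕ), k < d →
      Polynomial.eval₂ ((Polynomial.aeval θ : Polynomial 𝔽 →ₐ[𝔽] L) : Polynomial 𝔽 →+* L)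
          (ζ ^ q ^ k) (Qn n) =
        (Polynomial.eval θ
            ((𝔭.map (algebraMap 𝔽 L)) /ₘ (Polynomial.X - Polynomial.C (ζ ^ q ^ k)))) ^ (n + 1)) :
    ∀ (n : ℕ) (i : ℕ), i < d →
      c n i = expC (π' * Polynomial.aeval θ ((Qn n).coeff i) /
          (Polynomial.aeval θ 𝔭) ^ (n + 1)) ∧
      c n i = 𝔠 ((Qn n).coeff i) (expC (π' / (Polynomial.aeval θ 𝔭) ^ (n + 1))) := by
  clear hq
  subst hcard
  subst hdeg
  have hq1 : 1 < Fintype.card 𝔽 := Fintype.one_lt_card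
  have hθ1 : 1 < ‖θ‖ := by rw [hθ]; exact_mod_cast hq1
  have hper : ζ ^ Fintype.card 𝔽 ^ 𝔭.natDegree = ζ :=
    (hirr.pow_card_pow_eq_self_iff hζ _).mpr dvd_rfl
  have hζ1 : ‖ζ‖ ≤ 1 := norm_le_one_of_pow_eq_self (Nat.one_lt_pow hd.ne' hq1) hper
  have hζk : ∀ k, ‖ζ ^ Fintype.card 𝔽 ^ k‖ ≤ 1 := fun k => by
    rw [norm_pow]; exact pow_le_one₀ (norm_nonneg _) hζ1
  have hne : ∀ m k, θ ^ Fintype.card 𝔽 ^ m - ζ ^ Fintype.card 𝔽 ^ k ≠ 0 := fun m k h => by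
    have h1 : 1 < ‖θ ^ Fintype.card 𝔽 ^ m‖ := by
      rw [norm_pow]; exact one_lt_pow₀ hθ1 (pow_ne_zero _ (by omega))
    rw [sub_eq_zero.mp h] at h1
    exact (hζk k).not_gt h1
  have hP : Polynomial.aeval θ 𝔭 ≠ 0 := fun h => by
    refine pow_ne_self_of_one_lt_norm hθ1 (Nat.one_lt_pow hd.ne' hq1) ?_
    exact (hirr.pow_card_pow_eq_self_iff h _).mpr dvd_rfl
  have hexpX := CarlitzModule.exp_aeval_mul hc_add hc_mul hc_C hc_X
    (CarlitzModule.exp_add hexp) (CarlitzModule.exp_algebraMap_mul hexp)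
    (CarlitzModule.exp_theta_mul hθ1 hD0 hDrec hexp)
  intro n i hi
  have hmain : c n i = expC (π' * Polynomial.aeval θ ((Qn n).coeff i) /
      (Polynomial.aeval θ 𝔭) ^ (n + 1)) := by
    refine eq_of_sum_mul_pow_eq_s11 (FiniteField.injOn_pow_card_pow hirr hζ) (a := c n)
      (b := fun i => expC (π' * Polynomial.aeval θ ((Qn n).coeff i) /
        (Polynomial.aeval θ 𝔭) ^ (n + 1))) (fun k hk => ?_) hi
    rw [← hcV n k hk]
    refine (hPell n _ (hζk k)).unique ?_
    have hs := hasSum_sum (s := Finset.range 𝔭.natDegree) fun i _ =>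
      (hexp (π' * Polynomial.aeval θ ((Qn n).coeff i) /
        (Polynomial.aeval θ 𝔭) ^ (n + 1))).mul_right ((ζ ^ Fintype.card 𝔽 ^ k) ^ i)
    refine hs.congr_fun fun m => ?_
    have hint := FiniteField.sum_div_pow_card_pow_mul_pow (N := n + 1) hd hper hP
      (a := fun i => Polynomial.aeval θ ((Qn n).coeff i)) (fun j hj => ?_) m k (hne m k)
    · rw [← div_div, div_eq_mul_one_div, ← hint, Finset.mul_sum]
      refine Finset.sum_congr rfl fun i _ => ?_
      rw [mul_div_assoc π', mul_pow]
      ring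
    · have hnat : (Qn n).natDegree < 𝔭.natDegree := by
        rcases eq_or_ne (Qn n) 0 with h0 | h0
        · rwa [h0, Polynomial.natDegree_zero]
        · exact (Polynomial.natDegree_lt_iff_degree_lt h0).mpr (hQdeg n)
      rw [← FiniteField.sub_mul_eval_divByMonic hζ j θ, mul_pow, ← hQinterp n j hj,
        Polynomial.eval₂_eq_sum_range' _ hnat]
      rfl
  refine ⟨hmain, ?_⟩
  rw [hmain, ← hexpX]
  congr 1
  ring
end

section
/- For every n ≥ 0 and every 0 ≤ j ≤ n, the series L^{(j)}_ζ converges in L and satisfies L^{(j)}_ζ = −(π̃/𝔭^{n+1})·∑_a a_t^{(j)}(ζ)/exp_C(π̃·a/𝔭^{n+1}), where the sum runs over a set of representatives a ∈ A of the nonzero residue classes of A/𝔭^{n+1}A (for instance the nonzero polynomials a ∈ A of degree < (n+1)·d). -/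
section

open Polynomial Filter Topology Bornology

theorem sum_inv_sub_eq_inv_mul_prod {M L : Type*} [AddCommGroup M] [DecidableEq M] [Field L]
    (φ : M →+ L) (hφ : Function.Injective φ) (G : AddSubgroup M) (s : Finset M)
    (hs : ∀ x, x ∈ s ↔ x ∈ G) {z : L} (hz : ∀ x ∈ s, z ≠ φ x) :
    ∑ x ∈ s, (z - φ x)⁻¹ = (z * ∏ x ∈ s.erase 0, (1 - z / φ x))⁻¹ := by
  have h0 : (0 : M) ∈ s := (hs 0).2 G.zero_mem
  set c : L := ∏ x ∈ s.erase 0, (-φ x) with hc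
  have hc0 : c ≠ 0 := Finset.prod_ne_zero_iff.2 fun x hx =>
    neg_ne_zero.2 ((map_ne_zero_iff φ hφ).2 (Finset.ne_of_mem_erase hx))
  have key : derivative (∏ x ∈ s, (X - C (φ x))) - C c = 0 := by
    refine eq_zero_of_natDegree_lt_card_of_eval_eq_zero _ (ι := s) (f := fun x => φ x)
      (hφ.comp Subtype.val_injective) ?_ ?_
    · rintro ⟨x, hx⟩
      simp only [derivative_prod_finset, eval_sub, eval_finsetSum, eval_prod, eval_C,
        eval_X, derivative_X_sub_C, mul_one, sub_eq_zero]
      rw [Finset.sum_eq_single_of_mem x hx, hc]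
      · refine Finset.prod_nbij' (fun y => y - x) (fun y => y + x) ?_ ?_ ?_ ?_ ?_
        · intro y hy
          rw [Finset.mem_erase, hs] at hy ⊢
          exact ⟨sub_ne_zero.2 hy.1, G.sub_mem hy.2 ((hs x).1 hx)⟩
        · intro y hy
          rw [Finset.mem_erase, hs] at hy ⊢
          exact ⟨by simpa using hy.1, G.add_mem hy.2 ((hs x).1 hx)⟩
        · simp
        · simp
        · simp
      · intro y _ hyx
        exact Finset.prod_eq_zero (Finset.mem_erase.2 ⟨hyx.symm, hx⟩) (sub_self _)
    · have hdeg : (∏ x ∈ s, (X - C (φ x))).natDegree = s.card := by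
        simp [natDegree_prod_of_monic _ _ fun x _ => monic_X_sub_C (φ x)]
      rw [natDegree_sub_C, Fintype.card_coe, ← hdeg]
      exact natDegree_derivative_lt (by rw [hdeg]; exact Finset.card_ne_zero_of_mem h0)
  have hsum : ∑ x ∈ s, ∏ y ∈ s.erase x, (z - φ y) = c := by
    simpa [derivative_prod_finset, eval_finsetSum, eval_prod, sub_eq_zero] using congrArg (eval z) key
  have hprod : z * ∏ x ∈ s.erase 0, (1 - z / φ x) = (∏ x ∈ s, (z - φ x)) / c := by
    rw [← Finset.mul_prod_erase s _ h0, hc, mul_div_assoc, ← Finset.prod_div_distrib, map_zero,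
      sub_zero]
    congr 1
    refine Finset.prod_congr rfl fun x hx => ?_
    have := (map_ne_zero_iff φ hφ).2 (Finset.ne_of_mem_erase hx)
    field_simp
    ring
  rw [hprod, inv_div, ← hsum, Finset.sum_div]
  refine Finset.sum_congr rfl fun x hx => ?_
  have h1 : ∀ y ∈ s, z - φ y ≠ 0 := fun y hy => sub_ne_zero.2 (hz y hy)
  have h2 : ∏ y ∈ s.erase x, (z - φ y) ≠ 0 :=
    Finset.prod_ne_zero_iff.2 fun y hy => h1 y (Finset.mem_of_mem_erase hy)
  rw [← Finset.mul_prod_erase s _ hx, inv_eq_one_div, div_eq_div_iff (h1 x hx)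
    (mul_ne_zero (h1 x hx) h2)]
  ring

theorem aeval_hasseDeriv_pow_mul_eq_zero {R L : Type*} [CommRing R] [CommRing L] [Algebra R L]
    {ζ : L} {p : R[X]} (hζ : aeval ζ p = 0) {n j : ℕ} (hj : j ≤ n) (b : R[X]) :
    aeval ζ (hasseDeriv j (p ^ (n + 1) * b)) = 0 := by
  induction n generalizing j with
  | zero => simp_all
  | succ n ih =>
    rw [pow_succ', mul_assoc, hasseDeriv_mul, map_sum]
    refine Finset.sum_eq_zero fun ⟨i, k⟩ hik => ?_
    rw [Finset.HasAntidiagonal.mem_antidiagonal] at hik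
    rcases Nat.eq_zero_or_pos i with rfl | hi
    · simp [hζ]
    · rw [map_mul, ih (by grind), mul_zero]

section Norm

variable {F L : Type*} [Field F] [Finite F] [NormedField L] [Algebra F L]

theorem norm_algebraMap_eq_one_of_finite {c : F} (hc : c ≠ 0) : ‖algebraMap F L c‖ = 1 := by
  have : IsOfFinOrder (algebraMap F L c) :=
    (algebraMap F L).toMonoidHom.isOfFinOrder
      ((Units.coeHom F).isOfFinOrder (isOfFinOrder_of_finite (Units.mk0 c hc)))
  exact this.norm_eq_one

theorem norm_algebraMap_le_one_of_finite (c : F) : ‖algebraMap F L c‖ ≤ 1 := by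
  rcases eq_or_ne c 0 with rfl | hc
  · simp
  · exact (norm_algebraMap_eq_one_of_finite hc).le

variable [IsUltrametricDist L]

theorem norm_aeval_le_one_of_finite {x : L} (hx : ‖x‖ ≤ 1) (a : F[X]) : ‖aeval x a‖ ≤ 1 := by
  rw [aeval_eq_sum_range]
  refine IsUltrametricDist.norm_sum_le_of_forall_le_of_nonneg zero_le_one fun i _ => ?_
  rw [Algebra.smul_def, norm_mul, norm_pow]
  exact mul_le_one₀ (norm_algebraMap_le_one_of_finite _) (by positivity)
    (pow_le_one₀ (norm_nonneg _) hx)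

theorem norm_aeval_eq_pow_natDegree_of_finite {x : L} (hx : 1 < ‖x‖) {a : F[X]} (ha : a ≠ 0) :
    ‖aeval x a‖ = ‖x‖ ^ a.natDegree := by
  have hlead : ‖a.coeff a.natDegree • x ^ a.natDegree‖ = ‖x‖ ^ a.natDegree := by
    rw [Algebra.smul_def, norm_mul, norm_pow, norm_algebraMap_eq_one_of_finite (by simpa), one_mul]
  rw [aeval_eq_sum_range, Finset.sum_range_succ]
  have hlt : ‖∑ i ∈ Finset.range a.natDegree, a.coeff i • x ^ i‖ < ‖x‖ ^ a.natDegree := by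
    rcases Nat.eq_zero_or_pos a.natDegree with h | h
    · simp [h]
    · refine lt_of_le_of_lt (b := ‖x‖ ^ (a.natDegree - 1))
        (IsUltrametricDist.norm_sum_le_of_forall_le_of_nonneg (by positivity) fun i hi => ?_)
        (pow_lt_pow_right₀ hx (by omega))
      rw [Algebra.smul_def, norm_mul, norm_pow]
      refine (mul_le_of_le_one_left (by positivity) (norm_algebraMap_le_one_of_finite _)).trans
        (pow_le_pow_right₀ hx.le ?_)
      rw [Finset.mem_range] at hi
      omega
  rw [IsUltrametricDist.norm_add_eq_max_of_norm_ne_norm (by rw [hlead]; exact hlt.ne), hlead,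
    max_eq_right hlt.le]

theorem aeval_injective_of_one_lt_norm {x : L} (hx : 1 < ‖x‖) :
    Function.Injective (aeval x : F[X] →ₐ[F] L) := by
  refine (injective_iff_map_eq_zero _).2 fun a ha => ?_
  by_contra h
  have := norm_aeval_eq_pow_natDegree_of_finite hx h
  rw [ha, norm_zero] at this
  exact (pow_pos (zero_lt_one.trans hx) _).ne this

theorem norm_le_one_of_aeval_eq_zero {x : L} {a : F[X]} (ha : a ≠ 0) (h : aeval x a = 0) :
    ‖x‖ ≤ 1 := by
  by_contra! hx
  exact ha (aeval_injective_of_one_lt_norm hx (by simpa using h))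

theorem finite_setOf_degree_lt (m : ℕ) : {a : F[X] | a.degree < m}.Finite := by
  have : Finite (degreeLT F m) := Finite.of_equiv _ (degreeLTEquiv F m).symm.toEquiv
  exact (Set.toFinite (degreeLT F m : Set F[X])).subset fun a ha => mem_degreeLT.2 ha

theorem tendsto_aeval_cofinite_cobounded {x : L} (hx : 1 < ‖x‖) :
    Tendsto (fun a : F[X] => aeval x a) cofinite (cobounded L) := by
  rw [← tendsto_norm_atTop_iff_cobounded, tendsto_atTop]
  intro B
  obtain ⟨m, hm⟩ := pow_unbounded_of_one_lt B hx
  refine (finite_setOf_degree_lt m).subset fun a ha => ?_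
  by_contra hdeg
  have hdeg : (m : WithBot ℕ) ≤ a.degree := not_lt.1 hdeg
  have h0 : a ≠ 0 := by rintro rfl; simp at hdeg
  refine ha (hm.le.trans ?_)
  change _ ≤ ‖aeval x a‖
  rw [norm_aeval_eq_pow_natDegree_of_finite hx h0]
  exact pow_le_pow_right₀ hx.le (le_natDegree_of_coe_le_degree hdeg)

variable [CompleteSpace L]

theorem hasSum_inv_sub_of_hasProd {x : L} (hx : 1 < ‖x‖) {ϖ : L} (hϖ : ϖ ≠ 0) {z P : L}
    (hP : HasProd (fun a : {a : F[X] // a ≠ 0} => 1 - z / (ϖ * aeval x a.1)) P)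
    (hz : ∀ a : F[X], z ≠ ϖ * aeval x a) (hzP : z * P ≠ 0) :
    HasSum (fun a : F[X] => (z - ϖ * aeval x a)⁻¹) (z * P)⁻¹ := by
  classical
  have hsum : Summable fun a : F[X] => (z - ϖ * aeval x a)⁻¹ := by
    refine NonarchimedeanAddGroup.summable_of_tendsto_cofinite_zero
      (tendsto_inv₀_cobounded.comp ?_)
    exact (tendsto_const_sub_cobounded z).comp
      ((tendsto_mul_left_cobounded hϖ).comp (tendsto_aeval_cofinite_cobounded hx))
  let s : ℕ → Finset F[X] := fun m => (finite_setOf_degree_lt m).toFinset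
  have hs : ∀ m a, a ∈ s m ↔ a.degree < m := by simp [s]
  have hmono : Monotone s := fun m k hmk a ha => by
    rw [hs] at *
    exact ha.trans_le (by exact_mod_cast hmk)
  have hcof : ∀ a, ∃ m, a ∈ s m := fun a =>
    ⟨a.natDegree + 1,
      (hs _ _).2 (degree_le_natDegree.trans_lt (by exact_mod_cast Nat.lt_succ_self _))⟩
  have h1 : Tendsto (fun m => ∑ a ∈ s m, (z - ϖ * aeval x a)⁻¹) atTop
      (𝓝 (∑' a : F[X], (z - ϖ * aeval x a)⁻¹)) := by
    have := hsum.hasSum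
    rw [HasSum, SummationFilter.unconditional_filter] at this
    exact this.comp (tendsto_atTop_finset_of_monotone hmono hcof)
  have h2 : Tendsto (fun m => (z * ∏ a ∈ (s m).erase 0, (1 - z / (ϖ * aeval x a)))⁻¹) atTop
      (𝓝 (z * P)⁻¹) := by
    refine Tendsto.inv₀ (Tendsto.const_mul z ?_) hzP
    rw [HasProd, SummationFilter.unconditional_filter] at hP
    have := hP.comp (tendsto_atTop_finset_of_monotone
      (f := fun m => (s m).subtype (· ≠ 0)) (fun m k hmk => Finset.subtype_mono (hmono hmk))
      fun a => (hcof a.1).imp fun m hm => Finset.mem_subtype.2 hm)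
    refine this.congr fun m => ?_
    rw [← Finset.filter_ne', ← Finset.prod_subtype_eq_prod_filter]
    rfl
  let φ : F[X] →+ L := (AddMonoidHom.mulLeft ϖ).comp (aeval x : F[X] →ₐ[F] L).toAddMonoidHom
  have hφ : Function.Injective φ :=
    (mul_right_injective₀ hϖ).comp (aeval_injective_of_one_lt_norm hx)
  have := tendsto_nhds_unique (h1.congr fun m => sum_inv_sub_eq_inv_mul_prod φ hφ
    (degreeLT F m).toAddSubgroup (s m) (fun a => by rw [hs]; exact mem_degreeLT.symm)
    fun a _ => hz a) h2
  exact this ▸ hsum.hasSum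

end Norm

theorem bijective_sum_sub_mul_of_monic {F : Type*} [Field F] {M : F[X]} (hM : M.Monic) {N : ℕ}
    (hN : M.natDegree = N) :
    Function.Bijective fun vb : (Fin N → F) × F[X] =>
      ∑ i : Fin N, C (vb.1 i) * X ^ (i : ℕ) - M * vb.2 := by
  have hdeg : M.degree = N := by rw [degree_eq_natDegree hM.ne_zero, hN]
  constructor
  · rintro ⟨v, b⟩ ⟨w, c⟩ h
    have hu (v : Fin N → F) (b : F[X]) := div_modByMonic_unique
      (f := ∑ i : Fin N, C (v i) * X ^ (i : ℕ) - M * b) (-b) (∑ i : Fin N, C (v i) * X ^ (i : ℕ))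
      hM ⟨by ring, by rw [hdeg]; exact degree_sum_fin_lt v⟩
    have hv := hu v b
    simp only at h
    rw [h, (hu w c).1, (hu w c).2] at hv
    refine Prod.ext (funext fun k => ?_) (neg_injective hv.1).symm
    simpa [finsetSum_coeff, coeff_X_pow, Fin.val_inj] using congrArg (coeff · (k : ℕ)) hv.2.symm
  · intro a
    refine ⟨(fun i => (a %ₘ M).coeff i, -(a /ₘ M)), ?_⟩
    have hlt : (a %ₘ M).degree < N := hdeg ▸ degree_modByMonic_lt a hM
    have : ∑ i : Fin N, C ((a %ₘ M).coeff i) * X ^ (i : ℕ) = a %ₘ M := by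
      rw [Fin.sum_univ_eq_sum_range fun i => C ((a %ₘ M).coeff i) * X ^ i]
      ext k
      simp only [finsetSum_coeff, coeff_C_mul_X_pow]
      rw [Finset.sum_ite_eq]
      split_ifs with h
      · rfl
      · exact (coeff_eq_zero_of_degree_lt (hlt.trans_le (by simpa using h))).symm
    simp only [this, mul_neg, sub_neg_eq_add]
    exact modByMonic_add_div a M

theorem hasSum_monic_of_summable {F L : Type*} [Field F] [Fintype F] [NormedField L]
    [CompleteSpace L] [Algebra F L] {f : F[X] → L} (hf : Summable f) (h0 : f 0 = 0)
    (hC : ∀ c : F, c ≠ 0 → ∀ a, f (C c * a) = f a) :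
    HasSum (fun a : {a : F[X] // a.Monic} => f a.1) (-∑' a, f a) := by
  classical
  have hS : Summable fun a : {a : F[X] // a.Monic} => f a.1 :=
    hf.comp_injective Subtype.val_injective
  let g : Fˣ × {a : F[X] // a.Monic} → F[X] := fun x => C (x.1 : F) * x.2.1
  have hg : Function.Injective g := by
    rintro ⟨c, a, ha⟩ ⟨e, b, hb⟩ h
    have hce : (c : F) = e := by
      simpa [g, leadingCoeff_mul, ha.leadingCoeff, hb.leadingCoeff] using congrArg leadingCoeff h
    obtain rfl : c = e := Units.ext hce
    obtain rfl : a = b := mul_left_cancel₀ (C_ne_zero.2 c.ne_zero) h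
    rfl
  have hsupp : ∀ a ∉ Set.range g, f a = 0 := by
    intro a ha
    by_cases h : a = 0
    · rw [h, h0]
    · have hl := leadingCoeff_ne_zero.2 h
      refine (ha ⟨(Units.mk0 a.leadingCoeff hl, ⟨a * C a.leadingCoeff⁻¹,
        monic_mul_leadingCoeff_inv h⟩), ?_⟩).elim
      simp only [g, Units.val_mk0]
      rw [mul_left_comm, ← C_mul, mul_inv_cancel₀ hl, C_1, mul_one]
  have hprod := ((hg.hasSum_iff hsupp).2 hf.hasSum).prod_fiberwise fun c => by
    simpa [Function.comp_def, g, hC _ c.ne_zero] using hS.hasSum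
  have hcard : ((Fintype.card F : ℕ) : L) = 0 := by
    rw [← map_natCast (algebraMap F L), FiniteField.cast_card_eq_zero, map_zero]
  have hT := hprod.unique (hasSum_fintype _)
  rw [Finset.sum_const, Finset.card_univ, Fintype.card_units, nsmul_eq_mul,
    Nat.cast_sub Fintype.card_pos, hcard] at hT
  rw [hT]
  simpa using hS.hasSum

end

/-- Collapsing the twisted `A`-harmonic series.
In the Carlitz setting (`exp_C` the Carlitz exponential, `π̃` a fundamental period,
so `ker exp_C = π̃·A` and `exp_C(z) = z·∏_{0 ≠ λ ∈ π̃A}(1 - z/λ)`), for every `n ≥ 0`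
and `0 ≤ j ≤ n` the twisted `A`-harmonic series
`L^{(j)}_ζ := ∑_{a monic} a_t^{(j)}(ζ)/a` converges in `L` and satisfies
`L^{(j)}_ζ = -(π̃/𝔭^{n+1}) · ∑_a a_t^{(j)}(ζ)/exp_C(π̃ a/𝔭^{n+1})`,
the (finite) sum running over representatives of the nonzero residue classes of
`A/𝔭^{n+1}A`, namely the nonzero polynomials of degree `< (n+1)d`. -/
theorem stmt_12 {L : Type*} [NormedField L] [CompleteSpace L] [IsAlgClosed L]
    (hna : IsNonarchimedean (fun x : L => ‖x‖))
    (p q κ : ℕ) (hp : p.Prime) (hκ : 0 < κ) (hq : q = p ^ κ)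
    (𝔽 : Type*) [Field 𝔽] [Fintype 𝔽] [DecidableEq 𝔽] [Algebra 𝔽 L]
    (hcard : Fintype.card 𝔽 = q)
    (θ : L) (hθ : ‖θ‖ = q)
    (D : ℕ → L) (hD0 : D 0 = 1)
    (hDrec : ∀ m : ℕ, D (m + 1) = (θ ^ q ^ (m + 1) - θ) * D m ^ q)
    (expC : L → L)
    (hexp : ∀ z : L, HasSum (fun m : ℕ => z ^ q ^ m / D m) (expC z))
    (π' : L) (hπ : π' ≠ 0)
    (hker : ∀ z : L, expC z = 0 ↔ ∃ a : Polynomial 𝔽, z = π' * Polynomial.aeval θ a)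
    (hprod : ∀ z : L, ∃ P : L,
      HasProd (fun a : {a : Polynomial 𝔽 // a ≠ 0} =>
        1 - z / (π' * Polynomial.aeval θ a.1)) P ∧ expC z = z * P)
    (d : ℕ) (hd : 0 < d)
    (𝔭 : Polynomial 𝔽) (hmonic : 𝔭.Monic) (hirr : Irreducible 𝔭)
    (hdeg : 𝔭.natDegree = d)
    (ζ : L) (hζ : Polynomial.aeval ζ 𝔭 = 0) :
    ∀ (n : ℕ) (j : ℕ), j ≤ n →
      ∃ S : L,
        HasSum (fun a : {a : Polynomial 𝔽 // a.Monic} =>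
          Polynomial.aeval ζ (Polynomial.hasseDeriv j a.1) / Polynomial.aeval θ a.1) S ∧
        S = -(π' / (Polynomial.aeval θ 𝔭) ^ (n + 1)) *
          ∑ v ∈ Finset.univ.filter (fun v : Fin ((n + 1) * d) → 𝔽 => v ≠ 0),
            Polynomial.aeval ζ (Polynomial.hasseDeriv j
                (∑ i : Fin ((n + 1) * d), Polynomial.C (v i) * Polynomial.X ^ (i : ℕ))) /
              expC (π' * Polynomial.aeval θ
                  (∑ i : Fin ((n + 1) * d), Polynomial.C (v i) * Polynomial.X ^ (i : ℕ)) /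
                (Polynomial.aeval θ 𝔭) ^ (n + 1)) := by
  intro n j hj
  classical
  have := IsUltrametricDist.isUltrametricDist_of_isNonarchimedean_norm hna
  have hθ1 : 1 < ‖θ‖ := by
    rw [hθ, hq]
    exact_mod_cast Nat.one_lt_pow hκ.ne' hp.one_lt
  have hinj : Function.Injective (Polynomial.aeval θ : Polynomial 𝔽 →ₐ[𝔽] L) :=
    aeval_injective_of_one_lt_norm hθ1
  have hζ1 : ‖ζ‖ ≤ 1 := norm_le_one_of_aeval_eq_zero hmonic.ne_zero hζ
  set N := (n + 1) * d
  set M := 𝔭 ^ (n + 1) with hMdef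
  have hM : M.Monic := hmonic.pow _
  have hMdeg : M.natDegree = N := by rw [hMdef, hmonic.natDegree_pow, hdeg]
  have hMθ : Polynomial.aeval θ 𝔭 ^ (n + 1) = Polynomial.aeval θ M := (map_pow _ _ _).symm
  have hM0 : Polynomial.aeval θ M ≠ 0 := (map_ne_zero_iff _ hinj).2 hM.ne_zero
  rw [hMθ]
  let f : Polynomial 𝔽 → L := fun a =>
    Polynomial.aeval ζ (Polynomial.hasseDeriv j a) / Polynomial.aeval θ a
  have hf : Summable f := by
    refine NonarchimedeanAddGroup.summable_of_tendsto_cofinite_zero ?_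
    refine squeeze_zero_norm (fun a => ?_)
      (tendsto_norm_zero.comp (Filter.tendsto_inv₀_cobounded.comp
        (tendsto_aeval_cofinite_cobounded hθ1)))
    simp only [f, Function.comp_apply, div_eq_mul_inv, norm_mul]
    exact mul_le_of_le_one_left (norm_nonneg _) (norm_aeval_le_one_of_finite hζ1 _)
  refine ⟨_, hasSum_monic_of_summable hf (by simp [f]) fun c hc a => ?_, ?_⟩
  · have hc' : algebraMap 𝔽 L c ≠ 0 := by simpa
    simp only [f, ← Polynomial.smul_eq_C_mul, map_smul]
    rw [Algebra.smul_def, Algebra.smul_def, mul_div_mul_left _ _ hc']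
  rw [neg_mul, neg_inj, Finset.mul_sum]
  let r : (Fin N → 𝔽) → Polynomial 𝔽 := fun v => ∑ i, Polynomial.C (v i) * Polynomial.X ^ (i : ℕ)
  have hbij := bijective_sum_sub_mul_of_monic hM hMdeg
  have hsum := ((Equiv.ofBijective _ hbij).hasSum_iff.2 hf.hasSum).prod_fiberwise
    (g := fun v => π' / Polynomial.aeval θ M * (Polynomial.aeval ζ (Polynomial.hasseDeriv j (r v)) /
      expC (π' * Polynomial.aeval θ (r v) / Polynomial.aeval θ M))) fun v => ?_
  · rw [hsum.unique (hasSum_fintype _), Finset.sum_filter]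
    refine Finset.sum_congr rfl fun v _ => ?_
    split_ifs with hv
    · rfl
    · simp [r, not_not.1 hv]
  · have hnum (b : Polynomial 𝔽) : Polynomial.aeval ζ (Polynomial.hasseDeriv j (r v - M * b)) =
        Polynomial.aeval ζ (Polynomial.hasseDeriv j (r v)) := by
      rw [map_sub, map_sub, aeval_hasseDeriv_pow_mul_eq_zero hζ hj, sub_zero]
    have hterm (b : Polynomial 𝔽) : f (r v - M * b) =
        π' / Polynomial.aeval θ M * Polynomial.aeval ζ (Polynomial.hasseDeriv j (r v)) *
          (π' * Polynomial.aeval θ (r v) / Polynomial.aeval θ M - π' * Polynomial.aeval θ b)⁻¹ := by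
      have : π' * Polynomial.aeval θ (r v) / Polynomial.aeval θ M - π' * Polynomial.aeval θ b =
          π' / Polynomial.aeval θ M * Polynomial.aeval θ (r v - M * b) := by
        rw [map_sub, map_mul]
        field_simp
      rw [this, ← div_eq_mul_inv, mul_div_mul_left _ _ (div_ne_zero hπ hM0), ← hnum b]
    change HasSum (fun b => f (r v - M * b)) _
    simp only [hterm]
    rcases eq_or_ne v 0 with rfl | hv
    · simp [r]
    obtain ⟨P, hP, hzP⟩ := hprod (π' * Polynomial.aeval θ (r v) / Polynomial.aeval θ M)
    have hz (a : Polynomial 𝔽) :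
        π' * Polynomial.aeval θ (r v) / Polynomial.aeval θ M ≠ π' * Polynomial.aeval θ a := by
      intro h
      rw [mul_div_assoc, mul_right_inj' hπ, div_eq_iff hM0, ← map_mul] at h
      have heq : (v, a) = (0, 0) := by
        refine hbij.injective ?_
        change r v - M * a = r 0 - M * 0
        rw [hinj h, mul_comm, sub_self, mul_zero, sub_zero]
        exact (Finset.sum_eq_zero fun i _ => by simp).symm
      exact hv (congrArg Prod.fst heq)
    have hne : expC (π' * Polynomial.aeval θ (r v) / Polynomial.aeval θ M) ≠ 0 := by
      rw [Ne, hker, not_exists]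
      exact hz
    rw [hzP] at hne ⊢
    have hS := (hasSum_inv_sub_of_hasProd hθ1 hπ hP hz hne).mul_left
      (π' / Polynomial.aeval θ M * Polynomial.aeval ζ (Polynomial.hasseDeriv j (r v)))
    rwa [mul_assoc, ← div_eq_mul_inv] at hS
end

section
/- For all n ≥ 0, all 1 ≤ i ≤ d and all 0 ≤ j ≤ d−1, and for every ℚ-valued valuation w on K_n(ζ) extending v_i (normalized so that w(θ − ζ_i) = 1), one has w(ω^{(n)}(ζ_i^{q^j})) = q^j/(q^{dn}·(q^d − 1)). -/
section FrobeniusCycle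

variable {F : Type*} [Field F] {v : AddValuation F (WithTop ℚ)} {q d : ℕ}

theorem AddValuation.map_pow_eq_coe {x : F} {a : ℚ} (h : v x = (a : WithTop ℚ)) (n : ℕ) :
    v (x ^ n) = ((n * a : ℚ) : WithTop ℚ) := by
  rw [v.map_pow, h, ← WithTop.coe_nsmul, nsmul_eq_mul]

theorem AddValuation.eq_coe_of_map_pow {x : F} {a : ℚ} (hq : 0 < q)
    (h : v (x ^ q) = ((q * a : ℚ) : WithTop ℚ)) : v x = (a : WithTop ℚ) := by
  cases hx : v x with
  | top =>
    rw [(v.top_iff.mp hx), zero_pow hq.ne', v.map_zero] at h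
    exact absurd h WithTop.top_ne_coe
  | coe b =>
    rw [v.map_pow_eq_coe hx] at h
    have h' : (q * b : ℚ) = q * a := WithTop.coe_injective h
    have hq' : (q : ℚ) ≠ 0 := by exact_mod_cast hq.ne'
    rw [mul_left_cancel₀ hq' h']

theorem AddValuation.pos_of_map_pow {x : F} (h : 0 < v (x ^ q)) : 0 < v x := by
  by_contra! hx
  rw [v.map_pow] at h
  exact absurd h (not_lt.mpr (nsmul_nonpos hx q))

theorem AddValuation.map_eq_zero_of_pow_eq_one {x : F} {n : ℕ} (hn : 0 < n) (h : x ^ n = 1) :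
    v x = 0 :=
  v.eq_coe_of_map_pow hn (by rw [h, v.map_one]; simp)

/-- Valuations along a cycle `x j ^ q = u (j + 1) * x (j + 1)` in which exactly one coefficient
is a uniformizer and the others are units. -/
theorem AddValuation.map_of_frobenius_cycle (hq : 2 ≤ q) (hd : 0 < d) {u x : ℕ → F}
    (hu : ∀ j, 0 < j → j < d → v (u j) = 0) (hud : v (u d) = 1) (hx0 : x 0 ≠ 0)
    (hxd : x d = x 0) (hx : ∀ j, x j ^ q = u (j + 1) * x (j + 1)) {j : ℕ} (hj : j < d) :
    v (x j) = ((q ^ j / (q ^ d - 1) : ℚ) : WithTop ℚ) := by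
  obtain ⟨a, ha⟩ := WithTop.ne_top_iff_exists.mp (v.ne_top_iff.mpr hx0)
  have key : ∀ j, j < d → v (x j) = ((q ^ j * a : ℚ) : WithTop ℚ) := by
    intro j
    induction j with
    | zero => intro _; simp [ha]
    | succ j ih =>
      intro hj
      have h := v.map_pow_eq_coe (ih (by omega)) q
      rw [hx, v.map_mul, hu _ (by omega) hj, zero_add] at h
      rw [h, pow_succ' (q : ℚ), mul_assoc]
  obtain ⟨e, rfl⟩ : ∃ e, d = e + 1 := ⟨d - 1, by omega⟩
  have h := v.map_pow_eq_coe (key e (by omega)) q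
  rw [hx, v.map_mul, hud, hxd, ← ha, ← WithTop.coe_one, ← WithTop.coe_add] at h
  have heq : (1 + a : ℚ) = q * (q ^ e * a) := WithTop.coe_injective h
  have hq1 : (1 : ℚ) < q ^ (e + 1) := one_lt_pow₀ (by exact_mod_cast hq) (by omega)
  rw [key j hj]
  congr 1
  have : (q : ℚ) ^ (e + 1) - 1 ≠ 0 := by linarith
  field_simp
  linear_combination -heq

/-- Valuations along a cycle `x j ^ q = u (j + 1) * x (j + 1) + y (j + 1)` in which exactly one
coefficient is a uniformizer, the others are units, and the perturbation `y` has small positive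
valuation. -/
theorem AddValuation.map_of_frobenius_cycle_add (hq : 2 ≤ q) (hd : 0 < d) {u x y : ℕ → F}
    {b : ℚ} (hb : 0 < b) (hb1 : b ≤ 1)
    (hu : ∀ j, 0 < j → j < d → v (u j) = 0) (hud : v (u d) = 1)
    (hxd : x d = x 0) (hyd : y d = y 0)
    (hy : ∀ j, j < d → v (y j) = ((q ^ j * b : ℚ) : WithTop ℚ))
    (hx : ∀ j, x j ^ q = u (j + 1) * x (j + 1) + y (j + 1)) {j : ℕ} (hj : j < d) :
    v (x j) = ((q ^ j * (b / q ^ d) : ℚ) : WithTop ℚ) := by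
  have hq0 : (0 : ℚ) < q := by exact_mod_cast (by omega : 0 < q)
  have hq2 : (2 : ℚ) ≤ q := by exact_mod_cast hq
  have hypos : ∀ j, j ≤ d → 0 < v (y j) := by
    intro j hj
    rcases hj.lt_or_eq with h | rfl
    · rw [hy j h]; exact_mod_cast (by positivity)
    · rw [hyd, hy 0 hd]; exact_mod_cast (by positivity)
  have hunn : ∀ j, 0 < j → j ≤ d → 0 ≤ v (u j) := by
    intro j h0 hj
    rcases hj.lt_or_eq with h | rfl
    · rw [hu j h0 h]
    · rw [hud]; exact zero_le_one
  have hlt_succ : ∀ j, j < d → v (x j) < 0 → v (x (j + 1)) < v (x j) := by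
    intro j hj hneg
    obtain ⟨a, ha⟩ := WithTop.ne_top_iff_exists.mp (ne_top_of_lt hneg)
    rw [← ha] at hneg ⊢
    have ha0 : a < 0 := by exact_mod_cast hneg
    have hp := v.map_pow_eq_coe ha.symm q
    have h1 : ((q * a : ℚ) : WithTop ℚ) < a := by
      exact_mod_cast (by nlinarith : (q * a : ℚ) < a)
    have h2 : v (u (j + 1) * x (j + 1)) = ((q * a : ℚ) : WithTop ℚ) := by
      rw [← hp, eq_sub_of_add_eq (hx j).symm]
      apply v.map_sub_eq_of_lt_left
      rw [hp]
      exact (h1.trans hneg).trans (hypos _ hj)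
    rw [v.map_mul] at h2
    calc v (x (j + 1)) ≤ v (u (j + 1)) + v (x (j + 1)) :=
          le_add_of_nonneg_left (hunn _ (by omega) hj)
      _ < a := h2 ▸ h1
  have hx0 : 0 ≤ v (x 0) := by
    by_contra! h0
    have : ∀ k, k < d → v (x (k + 1)) < v (x 0) := by
      intro k
      induction k with
      | zero => exact fun hk => hlt_succ 0 hk h0
      | succ k ih =>
        intro hk
        have := ih (by omega)
        exact (hlt_succ _ hk (this.trans h0)).trans this
    have h := this (d - 1) (by omega)
    rw [Nat.sub_add_cancel hd, hxd] at h
    exact lt_irrefl _ h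
  have hud' : 1 ≤ v (u d * x d) := by
    rw [v.map_mul, hud, hxd]
    exact le_add_of_nonneg_right hx0
  have hxpos : ∀ r j, j + r + 1 = d → 0 < v (x j) := by
    intro r
    induction r with
    | zero =>
      intro j hj
      refine v.pos_of_map_pow (q := q) ?_
      rw [hx]
      refine v.map_lt_add ?_ (hypos _ (by omega))
      rw [show j + 1 = d by omega]
      exact zero_lt_one.trans_le hud'
    | succ r ih =>
      intro j hj
      refine v.pos_of_map_pow (q := q) ?_
      rw [hx]
      refine v.map_lt_add ?_ (hypos _ (by omega))
      rw [v.map_mul, hu _ (by omega) (by omega), zero_add]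
      exact ih _ (by omega)
  have hud'' : 1 < v (u d * x d) := by
    rw [v.map_mul, hud, hxd]
    have := hxpos (d - 1) 0 (by omega)
    cases h : v (x 0) with
    | top => simp
    | coe a =>
      rw [h] at this
      have : 0 < a := by exact_mod_cast this
      exact_mod_cast (by linarith : (1 : ℚ) < 1 + a)
  have main : ∀ r j, j + r + 1 = d → v (x j) = ((q ^ j * (b / q ^ d) : ℚ) : WithTop ℚ) := by
    intro r
    induction r with
    | zero =>
      intro j hj
      apply v.eq_coe_of_map_pow (q := q) (by omega)
      have hyd' : v (y d) = (b : WithTop ℚ) := by rw [hyd, hy 0 hd]; simp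
      rw [hx, show j + 1 = d by omega, v.map_add_eq_of_lt_right, hyd']
      · congr 1
        rw [← mul_assoc, ← pow_succ', show j + 1 = d by omega]
        field_simp
      · rw [hyd']
        exact lt_of_le_of_lt (by exact_mod_cast hb1) hud''
    | succ r ih =>
      intro j hj
      apply v.eq_coe_of_map_pow (q := q) (by omega)
      have h1 : v (u (j + 1) * x (j + 1)) = ((q ^ (j + 1) * (b / q ^ d) : ℚ) : WithTop ℚ) := by
        rw [v.map_mul, hu _ (by omega) (by omega), zero_add, ih _ (by omega)]
      rw [hx, v.map_add_eq_of_lt_left, h1, pow_succ', mul_assoc]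
      rw [h1, hy _ (by omega)]
      have : b / q ^ d < b := div_lt_self hb (one_lt_pow₀ (by linarith) (by omega))
      exact WithTop.coe_lt_coe.mpr (by gcongr)
  exact main (d - 1 - j) j (by omega)

end FrobeniusCycle

section PowerSeries

theorem HasSum.powerSeries_coeff_unique {L : Type*} [NormedField L] {c : L} (hc : 1 < ‖c‖)
    {a b : ℕ → L} {f : L → L} (ha : ∀ z : L, ‖z‖ ≤ 1 → HasSum (fun i => a i * z ^ i) (f z))
    (hb : ∀ z : L, ‖z‖ ≤ 1 → HasSum (fun i => b i * z ^ i) (f z)) : a = b := by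
  let _ : NontriviallyNormedField L := { ‹NormedField L› with non_trivial := ⟨c, hc⟩ }
  let p : FormalMultilinearSeries L L L :=
    fun n => ContinuousMultilinearMap.mkPiRing L (Fin n) (a n - b n)
  have hp : HasFPowerSeriesAt (0 : L → L) p 0 := by
    rw [hasFPowerSeriesAt_iff]
    filter_upwards [Metric.closedBall_mem_nhds (0 : L) one_pos] with z hz
    rw [mem_closedBall_zero_iff] at hz
    simpa [p, FormalMultilinearSeries.coeff, mul_sub, mul_comm] using (ha z hz).sub (hb z hz)
  funext n
  have h := congrArg (fun r => FormalMultilinearSeries.coeff r n) hp.eq_zero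
  simpa [p, FormalMultilinearSeries.coeff, sub_eq_zero] using h

variable {L : Type*} [NormedField L] {q : ℕ}

theorem HasSum.map_pow_of_add_pow (hq : 0 < q) (hadd : ∀ x y : L, (x + y) ^ q = x ^ q + y ^ q)
    {f : ℕ → L} {s : L} (h : HasSum f s) : HasSum (fun i => f i ^ q) (s ^ q) :=
  h.map (⟨⟨(· ^ q), zero_pow hq.ne'⟩, hadd⟩ : L →+ L) (continuous_pow q)

theorem HasSum.powerSeries_shift {a : ℕ → L} {z s : L} (h : HasSum (fun i => a i * z ^ i) s) :
    HasSum (fun i => (if i = 0 then 0 else a (i - 1)) * z ^ i) (z * s) := by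
  have h1 : HasSum (fun i => (if i + 1 = 0 then 0 else a (i + 1 - 1)) * z ^ (i + 1)) (z * s) := by
    refine HasSum.congr_fun (h.mul_left z) fun i => ?_
    rw [if_neg i.succ_ne_zero, Nat.add_sub_cancel]
    ring
  simpa using h1.zero_add (f := fun i => (if i = 0 then 0 else a (i - 1)) * z ^ i)

theorem norm_one_sub_of_norm_lt_one (hna : IsNonarchimedean (fun x : L => ‖x‖)) {x : L}
    (hx : ‖x‖ < 1) : ‖1 - x‖ = 1 := by
  apply le_antisymm
  · have := hna 1 (-x)
    simp only [norm_one, norm_neg, ← sub_eq_add_neg] at this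
    exact this.trans (max_le le_rfl hx.le)
  · have := hna (1 - x) x
    simp only [sub_add_cancel, norm_one] at this
    rcases le_max_iff.mp this with h | h
    · exact h
    · exact absurd hx (not_lt.mpr h)

variable {θ lamθ : L} {w : ℕ → L}

theorem norm_div_pow_lt_one (hθ : 1 < ‖θ‖) (hq : 0 < q) {z : L} (hz : ‖z‖ ≤ 1) (j : ℕ) :
    ‖z / θ ^ q ^ j‖ < 1 := by
  rw [norm_div, norm_pow]
  have h := one_lt_pow₀ hθ (pow_pos hq j).ne'
  exact (div_lt_one (by positivity)).mpr (hz.trans_lt h)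

/-- The functional equation `ω(y)^q = (y^q - θ) ω(y^q)` of the Anderson–Thakur function. -/
theorem andersonThakur_pow (hna : IsNonarchimedean (fun x : L => ‖x‖)) (hq : 0 < q)
    (hadd : ∀ x y : L, (x + y) ^ q = x ^ q + y ^ q) (hθ : 1 < ‖θ‖)
    (hlam : lamθ ^ (q - 1) = -θ) {y P Q : L} (hy : ‖y‖ ≤ 1)
    (hP : HasProd (fun j : ℕ => (1 - y / θ ^ q ^ j)⁻¹) P)
    (hQ : HasProd (fun j : ℕ => (1 - y ^ q / θ ^ q ^ j)⁻¹) Q) :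
    (lamθ * P) ^ q = (y ^ q - θ) * (lamθ * Q) := by
  have hsub : ∀ x : L, (1 - x) ^ q = 1 - x ^ q := by
    intro x
    have := hadd (1 - x) x
    rw [sub_add_cancel, one_pow] at this
    exact eq_sub_of_add_eq this.symm
  have hPq : HasProd (fun j : ℕ => (1 - y ^ q / θ ^ q ^ (j + 1))⁻¹) (P ^ q) := by
    refine HasProd.congr_fun (hP.map (powMonoidHom q : L →* L) (continuous_pow q)) fun j => ?_
    simp [hsub, div_pow, pow_succ, pow_mul]
  have hQ' := hPq.zero_mul (f := fun j : ℕ => (1 - y ^ q / θ ^ q ^ j)⁻¹)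
  have hQP := hQ.unique hQ'
  simp only [pow_zero, pow_one] at hQP
  have hθ0 : θ ≠ 0 := norm_pos_iff.mp (by linarith)
  have hne : 1 - y ^ q / θ ≠ 0 := by
    have h := norm_div_pow_lt_one hθ hq (z := y ^ q)
      (by rw [norm_pow]; exact pow_le_one₀ (norm_nonneg _) hy) 0
    rw [pow_zero, pow_one] at h
    rw [← norm_pos_iff, norm_one_sub_of_norm_lt_one hna h]
    exact one_pos
  have hPQ : P ^ q = (1 - y ^ q / θ) * Q := by rw [hQP, mul_inv_cancel_left₀ hne]
  have hlamq : lamθ ^ q = -θ * lamθ := by rw [← hlam, ← pow_succ, Nat.sub_add_cancel hq]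
  rw [mul_pow, hPQ, hlamq]
  field_simp
  ring

theorem andersonThakur_prod_ne_zero (hna : IsNonarchimedean (fun x : L => ‖x‖)) (hq : 0 < q)
    (hθ : 1 < ‖θ‖) {y P : L} (hy : ‖y‖ ≤ 1)
    (hP : HasProd (fun j : ℕ => (1 - y / θ ^ q ^ j)⁻¹) P) : P ≠ 0 := by
  have h := hP.norm
  have h1 : (fun j : ℕ => ‖(1 - y / θ ^ q ^ j)⁻¹‖) = fun _ => 1 := by
    funext j
    rw [norm_inv, norm_one_sub_of_norm_lt_one hna (norm_div_pow_lt_one hθ hq hy j), inv_one]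
  rw [h1] at h
  rw [← norm_pos_iff, h.unique hasProd_one]
  exact one_pos

/-- The coefficients of the Anderson–Thakur function form a compatible system of Carlitz
`θ ^ i`-torsion points. -/
theorem andersonThakur_coeff_pow [IsAlgClosed L] (hna : IsNonarchimedean (fun x : L => ‖x‖))
    (hq : 0 < q) (hadd : ∀ x y : L, (x + y) ^ q = x ^ q + y ^ q) (hθ : 1 < ‖θ‖)
    (hlam : lamθ ^ (q - 1) = -θ)
    (hω : ∀ z : L, ‖z‖ ≤ 1 → ∃ P : L,
      HasProd (fun j : ℕ => (1 - z / θ ^ q ^ j)⁻¹) P ∧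
      HasSum (fun i : ℕ => w i * z ^ i) (lamθ * P)) :
    w 0 ^ q = -θ * w 0 ∧ ∀ i, w (i + 1) ^ q = w i - θ * w (i + 1) := by
  choose! P hP hS using hω
  have key : (fun i => w i ^ q) = fun i => (if i = 0 then 0 else w (i - 1)) - θ * w i := by
    refine HasSum.powerSeries_coeff_unique hθ (f := fun z => (z - θ) * (lamθ * P z)) ?_ ?_
    · intro z hz
      obtain ⟨y, rfl⟩ := IsAlgClosed.exists_pow_nat_eq z hq
      have hy : ‖y‖ ≤ 1 := by
        rw [norm_pow] at hz
        exact (pow_le_one_iff_of_nonneg (norm_nonneg _) hq.ne').mp hz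
      have h := (hS y hy).map_pow_of_add_pow hq hadd
      rw [andersonThakur_pow hna hq hadd hθ hlam hy (hP y hy) (hP _ hz)] at h
      refine HasSum.congr_fun h fun i => ?_
      ring
    · intro z hz
      rw [sub_mul]
      refine HasSum.congr_fun ((hS z hz).powerSeries_shift.sub ((hS z hz).mul_left θ)) fun i => ?_
      ring
  refine ⟨?_, fun i => ?_⟩
  · simpa using congrFun key 0
  · simpa using congrFun key (i + 1)

variable {Ω : ℕ → L → L}

theorem hyperderiv_zero_pow (hq : 0 < q) (hadd : ∀ x y : L, (x + y) ^ q = x ^ q + y ^ q)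
    (hw0 : w 0 ^ q = -θ * w 0) (hw : ∀ i, w (i + 1) ^ q = w i - θ * w (i + 1))
    (hΩ : ∀ (n : ℕ) (z : L), ‖z‖ ≤ 1 →
      HasSum (fun i : ℕ => ((i + n).choose n : L) * w (i + n) * z ^ i) (Ω n z))
    {z : L} (hz : ‖z‖ ≤ 1) : Ω 0 z ^ q = (z ^ q - θ) * Ω 0 (z ^ q) := by
  have hzq : ‖z ^ q‖ ≤ 1 := by rw [norm_pow]; exact pow_le_one₀ (norm_nonneg _) hz
  have h := (hΩ 0 z hz).map_pow_of_add_pow hq hadd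
  have h0 := hΩ 0 _ hzq
  simp only [add_zero, Nat.choose_zero_right, Nat.cast_one, one_mul] at h h0
  refine h.unique ?_
  rw [sub_mul]
  refine HasSum.congr_fun (h0.powerSeries_shift.sub (h0.mul_left θ)) fun i => ?_
  rcases i with _ | i
  · simp [hw0]
  · simp only [Nat.succ_ne_zero, if_false, Nat.add_sub_cancel, mul_pow, hw]
    ring

theorem hyperderiv_succ_pow (hq : 0 < q) (hadd : ∀ x y : L, (x + y) ^ q = x ^ q + y ^ q)
    (hcast : ∀ m : ℕ, (m : L) ^ q = m)
    (hw : ∀ i, w (i + 1) ^ q = w i - θ * w (i + 1))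
    (hΩ : ∀ (n : ℕ) (z : L), ‖z‖ ≤ 1 →
      HasSum (fun i : ℕ => ((i + n).choose n : L) * w (i + n) * z ^ i) (Ω n z))
    (n : ℕ) {z : L} (hz : ‖z‖ ≤ 1) :
    Ω (n + 1) z ^ q = (z ^ q - θ) * Ω (n + 1) (z ^ q) + Ω n (z ^ q) := by
  have hzq : ‖z ^ q‖ ≤ 1 := by rw [norm_pow]; exact pow_le_one₀ (norm_nonneg _) hz
  refine ((hΩ (n + 1) z hz).map_pow_of_add_pow hq hadd).unique ?_
  have h1 : HasSum (fun i : ℕ => ((i + n).choose (n + 1) : L) * w (i + n) * (z ^ q) ^ i)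
      (z ^ q * Ω (n + 1) (z ^ q)) := by
    have : HasSum (fun i : ℕ => ((i + 1 + n).choose (n + 1) : L) * w (i + 1 + n) *
        (z ^ q) ^ (i + 1)) (z ^ q * Ω (n + 1) (z ^ q)) := by
      refine HasSum.congr_fun ((hΩ (n + 1) _ hzq).mul_left (z ^ q)) fun i => ?_
      rw [show i + 1 + n = i + (n + 1) by omega]
      ring
    simpa using this.zero_add
      (f := fun i : ℕ => ((i + n).choose (n + 1) : L) * w (i + n) * (z ^ q) ^ i)
  rw [sub_mul]
  refine HasSum.congr_fun ((h1.sub ((hΩ (n + 1) _ hzq).mul_left θ)).add (hΩ n _ hzq)) fun i => ?_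
  rw [mul_pow, mul_pow, hcast, ← add_assoc, hw, Nat.choose_succ_succ]
  push_cast
  ring

end PowerSeries

section CarlitzTorsion

open Polynomial

variable {𝔽 L : Type*} [Field 𝔽] [Field L]

theorem mem_subfield_of_sum_mul_pow_mem {S : Subfield L} {d : ℕ} {z x : ℕ → L}
    (hz : ∀ k, z k ∈ S) (hinj : Set.InjOn z (Finset.range d))
    (hsum : ∀ l : ℕ, ∑ k ∈ Finset.range d, z k ^ l * x k ∈ S) {k : ℕ} (hk : k < d) :
    x k ∈ S := by
  have hpoly : ∀ h : S[X], ∑ k ∈ Finset.range d, aeval (z k) h * x k ∈ S := by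
    intro h
    induction h using Polynomial.induction_on' with
    | add a b ha hb =>
      simp only [map_add, add_mul, Finset.sum_add_distrib]
      exact S.add_mem ha hb
    | monomial l s =>
      simp only [aeval_monomial, mul_assoc, ← Finset.mul_sum]
      exact S.mul_mem s.2 (hsum l)
  have hk' := Finset.mem_range.mpr hk
  have h := hpoly (∏ j ∈ (Finset.range d).erase k, (X - C (⟨z j, hz j⟩ : S)))
  have haeval : ∀ y : L, aeval y (∏ j ∈ (Finset.range d).erase k, (X - C (⟨z j, hz j⟩ : S))) =
      ∏ j ∈ (Finset.range d).erase k, (y - z j) := by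
    intro y
    rw [map_prod]
    refine Finset.prod_congr rfl fun j _ => ?_
    rw [map_sub, aeval_X, aeval_C]
    rfl
  simp only [haeval] at h
  rw [Finset.sum_eq_single_of_mem k hk'] at h
  · have hne : ∏ j ∈ (Finset.range d).erase k, (z k - z j) ≠ 0 := by
      refine Finset.prod_ne_zero_iff.mpr fun j hj => sub_ne_zero.mpr fun hkj => ?_
      obtain ⟨hjk, hj⟩ := Finset.mem_erase.mp hj
      exact hjk (hinj hk' hj hkj).symm
    have hS : ∏ j ∈ (Finset.range d).erase k, (z k - z j) ∈ S :=
      S.prod_mem fun j _ => S.sub_mem (hz k) (hz j)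
    have := S.mul_mem (S.inv_mem hS) h
    rwa [inv_mul_cancel_left₀ hne] at this
  · intro j hj hjk
    rw [Finset.prod_eq_zero (Finset.mem_erase.mpr ⟨hjk, hj⟩) (sub_self _), zero_mul]

variable {φ : 𝔽[X] →+* AddMonoid.End L}

theorem Polynomial.action_mul (a b : 𝔽[X]) (y : L) : φ (a * b) y = φ a (φ b y) := by
  rw [map_mul φ]
  rfl

theorem Polynomial.action_add (a b : 𝔽[X]) (y : L) : φ (a + b) y = φ a y + φ b y := by
  rw [map_add φ]
  rfl

theorem Polynomial.action_sub_mem_ker {N : 𝔽[X]} {t : 𝔽[X] → L}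
    (hadd : ∀ a b, t (a + b) = t a + t b) (hC : ∀ s g, φ (C s) (t g) = t (C s * g))
    (hX : ∀ g, φ N (φ X (t g) - t (X * g)) = 0) (a g : 𝔽[X]) :
    φ N (φ a (t g) - t (a * g)) = 0 := by
  have hX' : ∀ b, φ N (φ b (t g) - t (b * g)) = 0 →
      φ N (φ (X * b) (t g) - t (X * b * g)) = 0 := by
    intro b hb
    have h1 : φ (X * b) (t g) - t (X * b * g) =
        φ X (φ b (t g) - t (b * g)) + (φ X (t (b * g)) - t (X * (b * g))) := by
      rw [Polynomial.action_mul, map_sub, mul_assoc]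
      abel
    rw [h1, map_add, hX, add_zero, ← Polynomial.action_mul, mul_comm,
      Polynomial.action_mul, hb, map_zero]
  induction a using Polynomial.induction_on with
  | C s => rw [hC, sub_self, map_zero]
  | add a b ha hb =>
    rw [Polynomial.action_add, add_mul, hadd, add_sub_add_comm, map_add, ha, hb,
      add_zero]
  | monomial n s ih =>
    have h := hX' _ ih
    rwa [show X * (C s * X ^ n) = C s * X ^ (n + 1) by ring] at h

theorem Finset.sum_range_succ_of_periodic {M : Type*} [AddCommGroup M] {f : ℕ → M} {d : ℕ}
    (h : f d = f 0) : ∑ k ∈ Finset.range d, f (k + 1) = ∑ k ∈ Finset.range d, f k := by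
  have := (Finset.sum_range_succ f d).symm.trans (Finset.sum_range_succ' f d)
  rw [h] at this
  exact (add_right_cancel this).symm

variable [Fintype 𝔽] [Algebra 𝔽 L] {q d : ℕ} {θ : L} {𝔭 : 𝔽[X]}

theorem FiniteField.add_pow_of_card (hcard : Fintype.card 𝔽 = q) (x y : L) :
    (x + y) ^ q = x ^ q + y ^ q := by
  simpa [FiniteField.frobeniusAlgHom_apply, hcard] using
    map_add (FiniteField.frobeniusAlgHom 𝔽 L) x y

theorem FiniteField.natCast_pow_of_card (hcard : Fintype.card 𝔽 = q) (m : ℕ) :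
    (m : L) ^ q = m := by
  rw [← hcard, ← FiniteField.frobeniusAlgHom_apply 𝔽 L, map_natCast]

theorem FiniteField.sub_pow_card_pow (hcard : Fintype.card 𝔽 = q) (x y : L) (n : ℕ) :
    (x - y) ^ q ^ n = x ^ q ^ n - y ^ q ^ n := by
  induction n with
  | zero => simp
  | succ n ih =>
    simpa [pow_succ, pow_mul, ih, FiniteField.frobeniusAlgHom_apply, hcard] using
      map_sub (FiniteField.frobeniusAlgHom 𝔽 L) (x ^ q ^ n) (y ^ q ^ n)

theorem FiniteField.aeval_pow_of_card (hcard : Fintype.card 𝔽 = q) (y : L) (g : 𝔽[X]) :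
    aeval y g ^ q = aeval (y ^ q) g := by
  simpa [FiniteField.frobeniusAlgHom_apply, hcard] using
    (Polynomial.aeval_algHom_apply (FiniteField.frobeniusAlgHom 𝔽 L) y g).symm

theorem FiniteField.pow_card_pow_eq_self_iff (hcard : Fintype.card 𝔽 = q)
    (hirr : Irreducible 𝔭) (hmonic : 𝔭.Monic) {y : L} (hy : aeval y 𝔭 = 0) {r : ℕ} :
    y ^ q ^ r = y ↔ 𝔭.natDegree ∣ r := by
  rw [hirr.natDegree_dvd_iff_dvd_X_pow_card_pow_sub_X,
    minpoly.eq_of_irreducible_of_monic hirr hy hmonic, minpoly.dvd_iff, Nat.card_eq_fintype_card,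
    hcard]
  simp [sub_eq_zero]

/-- The traces `∑ g(ζ) ω^{(m)}(ζ)` over the roots of `𝔭` are `𝔭 ^ (m + 1)`-torsion. -/
theorem carlitz_pow_sum_eq_zero (hcard : Fintype.card 𝔽 = q)
    (hφC : ∀ s y, φ (C s) y = algebraMap 𝔽 L s * y) (hφX : ∀ y, φ X y = y ^ q + θ * y)
    {z : ℕ → L} {x : ℕ → ℕ → L} (hz : ∀ k, z (k + 1) = z k ^ q) (hzd : z d = z 0)
    (hroot : ∀ k, aeval (z k) 𝔭 = 0) (hxd : ∀ m, x m d = x m 0)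
    (hx0 : ∀ k, x 0 k ^ q = (z (k + 1) - θ) * x 0 (k + 1))
    (hx : ∀ m k, x (m + 1) k ^ q = (z (k + 1) - θ) * x (m + 1) (k + 1) + x m (k + 1))
    (m : ℕ) (g : 𝔽[X]) :
    φ (𝔭 ^ (m + 1)) (∑ k ∈ Finset.range d, aeval (z k) g * x m k) = 0 := by
  set T : ℕ → 𝔽[X] → L := fun m g => ∑ k ∈ Finset.range d, aeval (z k) g * x m k with hT
  have hTadd : ∀ m a b, T m (a + b) = T m a + T m b := by
    intro m a b
    simp only [hT, map_add, add_mul, Finset.sum_add_distrib]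
  have hTC : ∀ m s g, φ (C s) (T m g) = T m (C s * g) := by
    intro m s g
    simp only [hT, hφC, map_mul, aeval_C, mul_assoc, Finset.mul_sum]
  have hT𝔭 : ∀ m g, T m (𝔭 * g) = 0 := by
    intro m g
    simp only [hT, map_mul, hroot, zero_mul, Finset.sum_const_zero]
  have hpow : ∀ m g, T m g ^ q = ∑ k ∈ Finset.range d, aeval (z (k + 1)) g * x m k ^ q := by
    intro m g
    have h := map_sum (FiniteField.frobeniusAlgHom 𝔽 L) (fun k => aeval (z k) g * x m k)
      (Finset.range d)
    simp only [FiniteField.frobeniusAlgHom_apply, hcard, mul_pow,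
      FiniteField.aeval_pow_of_card hcard, ← hz] at h
    exact h
  have hX0 : ∀ g, φ X (T 0 g) = T 0 (X * g) := by
    intro g
    rw [hφX, hpow]
    simp only [hx0]
    rw [Finset.sum_range_succ_of_periodic (f := fun k => aeval (z k) g * ((z k - θ) * x 0 k))
      (by rw [hzd, hxd])]
    simp only [hT, Finset.mul_sum, ← Finset.sum_add_distrib, map_mul, aeval_X]
    exact Finset.sum_congr rfl fun k _ => by ring
  have hXs : ∀ m g, φ X (T (m + 1) g) = T (m + 1) (X * g) + T m g := by
    intro m g
    rw [hφX, hpow]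
    simp only [hx]
    rw [Finset.sum_range_succ_of_periodic
      (f := fun k => aeval (z k) g * ((z k - θ) * x (m + 1) k + x m k)) (by rw [hzd, hxd, hxd])]
    simp only [hT, Finset.mul_sum, ← Finset.sum_add_distrib, map_mul, aeval_X]
    exact Finset.sum_congr rfl fun k _ => by ring
  change φ (𝔭 ^ (m + 1)) (T m g) = 0
  induction m generalizing g with
  | zero =>
    have h := Polynomial.action_sub_mem_ker (φ := φ) (N := 1) (hTadd 0) (hTC 0)
      (fun g => by rw [hX0, sub_self, map_zero]) 𝔭 g
    rw [hT𝔭, sub_zero, map_one, AddMonoid.End.one_apply] at h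
    rw [zero_add, pow_one, h]
  | succ m ih =>
    have h := Polynomial.action_sub_mem_ker (φ := φ) (N := 𝔭 ^ (m + 1)) (hTadd (m + 1))
      (hTC (m + 1)) (fun g => by rw [hXs, add_sub_cancel_left, ih]) 𝔭 g
    rw [hT𝔭, sub_zero] at h
    rw [pow_succ, Polynomial.action_mul, h]

end CarlitzTorsion

/-- Valuations of `ω^{(n)}` at the primes above `𝔭`.
In the Carlitz/Anderson–Thakur setting, for all `n ≥ 0`, `1 ≤ i ≤ d` and
`0 ≤ j ≤ d-1`, and for every `ℚ`-valued valuation `w` on `K_n(ζ)` extending the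
`(θ-ζ_i)`-adic valuation `v_i` (normalized so that `w(θ-ζ_i) = 1`), one has
`w(ω^{(n)}(ζ_i^{q^j})) = q^j/(q^{dn}(q^d - 1))`.  (Here the valuation `w` is encoded
as a function `L → WithTop ℚ` which is a valuation on the subfield `K_n(ζ)`;
note that any valuation on `K_n(ζ)` with `w(θ-ζ_i) = 1` automatically extends
`v_i`.) -/
theorem stmt_14 {L : Type*} [NormedField L] [CompleteSpace L] [IsAlgClosed L]
    (hna : IsNonarchimedean (fun x : L => ‖x‖))
    (p q κ : ℕ) (hp : p.Prime) (hκ : 0 < κ) (hq : q = p ^ κ)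
    (𝔽 : Type*) [Field 𝔽] [Fintype 𝔽] [Algebra 𝔽 L] (hcard : Fintype.card 𝔽 = q)
    (θ : L) (hθ : ‖θ‖ = q)
    (𝔠 : Polynomial 𝔽 → L → L)
    (hc_add : ∀ a b : Polynomial 𝔽, ∀ x : L, 𝔠 (a + b) x = 𝔠 a x + 𝔠 b x)
    (hc_mul : ∀ a b : Polynomial 𝔽, ∀ x : L, 𝔠 (a * b) x = 𝔠 a (𝔠 b x))
    (hc_C : ∀ (s : 𝔽) (x : L), 𝔠 (Polynomial.C s) x = algebraMap 𝔽 L s * x)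
    (hc_X : ∀ x : L, 𝔠 Polynomial.X x = x ^ q + θ * x)
    (hc_lin : ∀ (a : Polynomial 𝔽) (x y : L), 𝔠 a (x + y) = 𝔠 a x + 𝔠 a y)
    (hc_smul : ∀ (a : Polynomial 𝔽) (s : 𝔽) (x : L),
      𝔠 a (algebraMap 𝔽 L s * x) = algebraMap 𝔽 L s * 𝔠 a x)
    (lamθ : L) (hlamθ : lamθ ^ (q - 1) = -θ)
    (w : ℕ → L) (hw0 : Filter.Tendsto (fun i => ‖w i‖) Filter.atTop (nhds 0))
    (hωdef : ∀ z : L, ‖z‖ ≤ 1 → ∃ P : L,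
      HasProd (fun j : ℕ => (1 - z / θ ^ q ^ j)⁻¹) P ∧
      HasSum (fun i : ℕ => w i * z ^ i) (lamθ * P))
    (Ω : ℕ → L → L)
    (hΩ : ∀ (n : ℕ) (z : L), ‖z‖ ≤ 1 →
      HasSum (fun i : ℕ => ((i + n).choose n : L) * w (i + n) * z ^ i) (Ω n z))
    (d : ℕ) (hd : 0 < d)
    (𝔭 : Polynomial 𝔽) (hmonic : 𝔭.Monic) (hirr : Irreducible 𝔭)
    (hdeg : 𝔭.natDegree = d)
    (ζ : L) (hζ : Polynomial.aeval ζ 𝔭 = 0) :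
    ∀ n : ℕ, ∀ i : ℕ, 1 ≤ i → i ≤ d →
      ∀ v : L → WithTop ℚ,
        (let Knζ : Subfield L := Subfield.closure
          (Set.range (algebraMap 𝔽 L) ∪ {θ, ζ} ∪ {y : L | 𝔠 (𝔭 ^ (n + 1)) y = 0})
        (∀ x ∈ Knζ, ∀ y ∈ Knζ, v (x * y) = v x + v y) ∧
        (∀ x ∈ Knζ, ∀ y ∈ Knζ, min (v x) (v y) ≤ v (x + y)) ∧
        (∀ x ∈ Knζ, (v x = ⊤ ↔ x = 0))) →
        v (θ - ζ ^ q ^ (i - 1)) = 1 →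
        ∀ j : ℕ, j ≤ d - 1 →
          (Ω n (ζ ^ q ^ (i - 1 + j)) ∈ Subfield.closure
            (Set.range (algebraMap 𝔽 L) ∪ {θ, ζ} ∪ {y : L | 𝔠 (𝔭 ^ (n + 1)) y = 0})) ∧
          v (Ω n (ζ ^ q ^ (i - 1 + j))) =
            ((q ^ j / (q ^ (d * n) * (q ^ d - 1)) : ℚ) : WithTop ℚ) := by
  have hq2 : 2 ≤ q := hq ▸ hp.two_le.trans (Nat.le_self_pow hκ.ne' p)
  have hq0 : 0 < q := by omega
  have hθ1 : 1 < ‖θ‖ := by rw [hθ]; exact_mod_cast hq2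
  have hfrob := FiniteField.add_pow_of_card (L := L) hcard
  obtain ⟨hwz, hws⟩ := andersonThakur_coeff_pow hna hq0 hfrob hθ1 hlamθ hωdef
  intro n i _ _ v hv hvθ j hj
  obtain ⟨e, rfl⟩ : ∃ e, i = e + 1 := ⟨i - 1, by omega⟩
  rw [Nat.add_sub_cancel] at hvθ ⊢
  set S : Subfield L := Subfield.closure
    (Set.range (algebraMap 𝔽 L) ∪ {θ, ζ} ∪ {y : L | 𝔠 (𝔭 ^ (n + 1)) y = 0})
  obtain ⟨hvmul, hvadd, hvtop⟩ := hv
  have hθS : θ ∈ S := Subfield.subset_closure (by simp)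
  have hζS : ζ ∈ S := Subfield.subset_closure (by simp)
  have htors : ∀ y, 𝔠 (𝔭 ^ (n + 1)) y = 0 → y ∈ S :=
    fun y hy => Subfield.subset_closure (Or.inr hy)
  have hroot : ∀ k, Polynomial.aeval (ζ ^ q ^ k) 𝔭 = 0 := by
    intro k
    induction k with
    | zero => simpa using hζ
    | succ k ih =>
      rw [pow_succ, pow_mul, ← FiniteField.aeval_pow_of_card hcard, ih, zero_pow hq0.ne']
  have hfix : ∀ k r, (ζ ^ q ^ k) ^ q ^ r = ζ ^ q ^ k ↔ d ∣ r := fun k r => by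
    rw [FiniteField.pow_card_pow_eq_self_iff hcard hirr hmonic (hroot k), hdeg]
  have hζ1 : ‖ζ‖ ≤ 1 := by
    by_contra! h
    have h1 := congrArg norm ((hfix 0 d).mpr dvd_rfl)
    rw [pow_zero, pow_one, norm_pow] at h1
    exact (lt_self_pow₀ h (Nat.one_lt_pow hd.ne' hq2)).ne' h1
  have hζk : ∀ k, ‖ζ ^ q ^ k‖ ≤ 1 := fun k => by
    rw [norm_pow]; exact pow_le_one₀ (norm_nonneg _) hζ1
  set z : ℕ → L := fun k => ζ ^ q ^ (e + k) with hz
  have hzsucc : ∀ k, z (k + 1) = z k ^ q := fun k => by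
    simp only [hz, ← add_assoc, pow_succ, pow_mul]
  have hzadd : ∀ k r, z (k + r) = z k ^ q ^ r := fun k r => by
    simp only [hz, pow_add, pow_mul]
  have hzd : ∀ k, z (k + d) = z k := fun k => by
    rw [hzadd]; exact (hfix _ d).mpr dvd_rfl
  have hzd0 : z d = z 0 := by simpa using hzd 0
  have hzne : ∀ k r, 0 < r → r < d → z (k + r) ≠ z k := by
    intro k r h0 hr h
    rw [hzadd] at h
    exact absurd (Nat.le_of_dvd h0 ((hfix _ r).mp h)) (by omega)
  have hzS : ∀ k, z k ∈ S := fun k => S.pow_mem hζS _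
  have hrec0 : ∀ k, Ω 0 (z k) ^ q = (z (k + 1) - θ) * Ω 0 (z (k + 1)) := fun k => by
    rw [hzsucc]; exact hyperderiv_zero_pow hq0 hfrob hwz hws hΩ (hζk _)
  have hrec : ∀ m k, Ω (m + 1) (z k) ^ q =
      (z (k + 1) - θ) * Ω (m + 1) (z (k + 1)) + Ω m (z (k + 1)) := fun m k => by
    rw [hzsucc]
    exact hyperderiv_succ_pow hq0 hfrob (FiniteField.natCast_pow_of_card hcard) hws hΩ m (hζk _)
  have hΩS : ∀ m ≤ n, ∀ k, Ω m (z k) ∈ S := by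
    intro m hm k
    have hc_one : ∀ x, 𝔠 1 x = x := fun x => by simpa using hc_C 1 x
    have hc_zero : ∀ x, 𝔠 0 x = 0 := fun x => by simpa using hc_C 0 x
    let φ : Polynomial 𝔽 →+* AddMonoid.End L :=
      { toFun := fun a => AddMonoidHom.mk' (𝔠 a) (hc_lin a)
        map_one' := by ext x; exact hc_one x
        map_mul' := fun a b => by ext x; exact hc_mul a b x
        map_zero' := by ext x; exact hc_zero x
        map_add' := fun a b => by ext x; exact hc_add a b x }
    have hsum : ∀ l : ℕ, ∑ r ∈ Finset.range d, z (k + r) ^ l * Ω m (z (k + r)) ∈ S := by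
      intro l
      have h := carlitz_pow_sum_eq_zero (φ := φ) (𝔭 := 𝔭) (d := d) hcard hc_C hc_X
        (z := fun r => z (k + r)) (x := fun m r => Ω m (z (k + r))) (fun r => hzsucc _)
        (hzd k) (fun r => hroot _) (fun m => by simp only [hzd, add_zero])
        (fun r => hrec0 _) (fun m r => hrec m _) m (Polynomial.X ^ l)
      simp only [map_pow, Polynomial.aeval_X] at h
      apply htors
      rw [show n + 1 = (n - m) + (m + 1) by omega, pow_add, hc_mul]
      rw [← map_pow] at h
      exact (congrArg (φ (𝔭 ^ (n - m))) h).trans (map_zero _)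
    refine mem_subfield_of_sum_mul_pow_mem (z := fun r => z (k + r))
      (x := fun r => Ω m (z (k + r))) (fun r => hzS _) ?_ hsum hd
    intro a ha b hb hab
    rw [Finset.coe_range, Set.mem_Iio] at ha hb
    by_contra hne
    rcases Nat.lt_or_gt_of_ne hne with hlt | hlt
    · apply hzne (k + a) (b - a) (by omega) (by omega)
      rw [show k + a + (b - a) = k + b by omega]
      exact hab.symm
    · apply hzne (k + b) (a - b) (by omega) (by omega)
      rw [show k + b + (a - b) = k + a by omega]
      exact hab
  refine ⟨hΩS n le_rfl j, ?_⟩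
  have hv1 : v 1 = 0 := by
    obtain ⟨a, ha⟩ := WithTop.ne_top_iff_exists.mp
      (fun h => one_ne_zero ((hvtop 1 S.one_mem).mp h) : v 1 ≠ ⊤)
    have h := hvmul 1 S.one_mem 1 S.one_mem
    rw [mul_one, ← ha] at h
    have h' : a = a + a := by exact_mod_cast h
    rw [← ha, show a = 0 by linarith, WithTop.coe_zero]
  let V : AddValuation S (WithTop ℚ) := AddValuation.of (fun x => v x)
    ((hvtop _ S.zero_mem).mpr rfl) hv1 (fun x y => hvadd x x.2 y y.2)
    (fun x y => hvmul x x.2 y y.2)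
  let zS : ℕ → S := fun k => ⟨z k, hzS k⟩
  let θS : S := ⟨θ, hθS⟩
  have hVθ : V (zS 0 - θS) = 1 := by rw [V.map_sub_swap]; exact hvθ
  have hud : V (zS d - θS) = 1 := by
    rw [show zS d = zS 0 from Subtype.ext hzd0, hVθ]
  have hu : ∀ k, 0 < k → k < d → V (zS k - θS) = 0 := by
    intro k h0 hk
    have hconst : V (zS k - zS 0) = 0 := by
      refine V.map_eq_zero_of_pow_eq_one (n := q ^ d - 1)
        (Nat.sub_pos_of_lt (Nat.one_lt_pow hd.ne' hq2)) (Subtype.ext ?_)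
      have hne : z k - z 0 ≠ 0 := sub_ne_zero.mpr (by simpa using hzne 0 k h0 hk)
      change (z k - z 0) ^ (q ^ d - 1) = 1
      apply mul_right_cancel₀ hne
      rw [← pow_succ, Nat.sub_add_cancel (Nat.one_le_pow _ _ hq0),
        FiniteField.sub_pow_card_pow hcard, ← hzadd, ← hzadd, hzd, hzd, one_mul]
    rw [← sub_add_sub_cancel (zS k) (zS 0) θS, V.map_add_eq_of_lt_left, hconst]
    rw [hconst, hVθ]
    exact zero_lt_one
  have hqd : (1 : ℚ) ≤ q ^ d - 1 := by
    have h1 : (q : ℚ) ≤ q ^ d := le_self_pow₀ (by exact_mod_cast hq0) hd.ne'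
    have h2 : (2 : ℚ) ≤ q := by exact_mod_cast hq2
    linarith
  have hqQ : (1 : ℚ) ≤ q := by exact_mod_cast hq0
  have main : ∀ m (hm : m ≤ n), ∀ k, k < d → V ⟨Ω m (z k), hΩS m hm k⟩ =
      ((q ^ k * (1 / (q ^ (d * m) * (q ^ d - 1))) : ℚ) : WithTop ℚ) := by
    intro m
    induction m with
    | zero =>
      intro hm k hk
      obtain ⟨P, hP, hPsum⟩ := hωdef (z 0) (hζk _)
      have hΩ0 := hΩ 0 (z 0) (hζk _)
      simp only [add_zero, Nat.choose_zero_right, Nat.cast_one, one_mul] at hΩ0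
      have hne : Ω 0 (z 0) ≠ 0 := by
        rw [hΩ0.unique hPsum]
        refine mul_ne_zero ?_ (andersonThakur_prod_ne_zero hna hq0 hθ1 (hζk _) hP)
        rintro rfl
        rw [zero_pow (by omega), zero_eq_neg] at hlamθ
        rw [hlamθ, norm_zero] at hθ1
        linarith
      rw [V.map_of_frobenius_cycle (x := fun k => ⟨Ω 0 (z k), hΩS 0 hm k⟩)
        (u := fun k => zS k - θS) hq2 hd hu hud
        (fun h => hne (congrArg Subtype.val h))
        (Subtype.ext (congrArg (Ω 0) hzd0))
        (fun k => Subtype.ext (hrec0 k)) hk]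
      congr 1
      rw [mul_zero, pow_zero, one_mul, mul_one_div]
    | succ m ih =>
      intro hm k hk
      have hq1 : (1 : ℚ) ≤ q ^ (d * m) := one_le_pow₀ hqQ
      rw [V.map_of_frobenius_cycle_add (x := fun k => ⟨Ω (m + 1) (z k), hΩS (m + 1) hm k⟩)
        (y := fun k => ⟨Ω m (z k), hΩS m (by omega) k⟩) (u := fun k => zS k - θS)
        hq2 hd (b := 1 / (q ^ (d * m) * (q ^ d - 1)))
        (by positivity) (by rw [div_le_one (by positivity)]; nlinarith) hu hud
        (Subtype.ext (congrArg (Ω (m + 1)) hzd0))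
        (Subtype.ext (congrArg (Ω m) hzd0))
        (ih (by omega))
        (fun k => Subtype.ext (hrec m k)) hk]
      congr 1
      rw [mul_add, mul_one, pow_add]
      field_simp
  have h := main n le_rfl j (by omega)
  rw [mul_one_div] at h
  exact h
end
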